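/- For every POMDP Γ = (K, A, S, q, g), every initial belief p₁ ∈ Δ(K), and every ε > 0, there exists a strategy σ with finite memory that is ε-optimal in Γ(p₁), i.e., γ^{p₁}_∞(σ) ≥ v_∞(p₁) − ε. -/

import Mathlib

open MeasureTheory Filter

namespace PomdpPaper

/-- A belief (probability vector) on `Fin n`. -/
def IsBelief {n : ℕ} (p : Fin n → ℝ) : Prop :=
  (∀ k, 0 ≤ p k) ∧ ∑ k, p k = 1

/-- The measure on a finite type associated with a probability vector. -/
noncomputable def vecMeasure {α : Type*} [Fintype α] [MeasurableSpace α] (p : α → ℝ) :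
    Measure α :=
  ∑ x : α, ENNReal.ofReal (p x) • Measure.dirac x

/-- The Dirac belief at a point. -/
def diracBelief {n : ℕ} (k : Fin n) : Fin n → ℝ := fun k' => if k' = k then 1 else 0

/-- The `i`-th binary digit of a real number `x ∈ [0,1)` (as a real number `0` or `1`). -/
noncomputable def digitR (x : ℝ) (i : ℕ) : ℝ :=
  if ⌊x * 2 ^ (i + 1)⌋ % 2 = 1 then 1 else 0

/-- From one uniform seed `x ∈ [0,1)`, a sequence `unif x 0, unif x 1, …` of
(independent, uniformly distributed on `[0,1]`) real numbers, obtained by splitting the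
binary digits of `x` along the pairing function. -/
noncomputable def unif (x : ℝ) (m : ℕ) : ℝ :=
  ∑' j : ℕ, digitR x (Nat.pair m j) / 2 ^ (j + 1)

open Classical in
/-- Inverse-transform sampling from a probability vector on `Fin n` using a seed `u ∈ [0,1]`. -/
noncomputable def sampleFin {n : ℕ} (hn : 0 < n) (p : Fin n → ℝ) (u : ℝ) : Fin n :=
  let s : Finset (Fin n) :=
    Finset.univ.filter fun y : Fin n => u < ∑ z ∈ Finset.univ.filter fun z : Fin n => z ≤ y, p z
  if hs : s.Nonempty then s.min' hs else ⟨0, hn⟩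

/-- Inverse-transform sampling from a probability vector on a finite nonempty type. -/
noncomputable def sampleOn {β : Type*} [Fintype β] [Nonempty β] (p : β → ℝ) (u : ℝ) : β :=
  (Fintype.equivFin β).symm
    (sampleFin Fintype.card_pos (fun i => p ((Fintype.equivFin β).symm i)) u)

/-- A POMDP with states `Fin nK`, actions `Fin nA`, signals `Fin nS`, transition function `q`
and reward function `g` with values in `[0,1]`. -/
structure POMDP where
  nK : ℕ
  nA : ℕ
  nS : ℕ
  hK : 0 < nK
  hA : 0 < nA
  hS : 0 < nS
  q : Fin nK → Fin nA → Fin nK × Fin nS → ℝ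
  q_nonneg : ∀ k a y, 0 ≤ q k a y
  q_sum : ∀ k a, ∑ y, q k a y = 1
  g : Fin nK → Fin nA → ℝ
  g_nonneg : ∀ k a, 0 ≤ g k a
  g_le_one : ∀ k a, g k a ≤ 1

namespace POMDP

variable (Γ : POMDP)

/-- The state space. -/
abbrev K := Fin Γ.nK
/-- The action space. -/
abbrev A := Fin Γ.nA
/-- The signal space. -/
abbrev S := Fin Γ.nS

instance : Nonempty Γ.K := ⟨⟨0, Γ.hK⟩⟩
instance : Nonempty Γ.A := ⟨⟨0, Γ.hA⟩⟩
instance : Nonempty Γ.S := ⟨⟨0, Γ.hS⟩⟩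

/-- A history: the finite sequence of past actions and signals. -/
abbrev Hist := List (Γ.A × Γ.S)

/-- A (pure) strategy: a map from histories to actions. -/
abbrev Strategy := Γ.Hist → Γ.A

/-- The sample space carrying all the randomness: an initial state together with a
uniform seed in `[0,1)` used to draw all the transitions. -/
abbrev Env := Γ.K × ℝ

/-- The probability measure on the sample space induced by the initial belief `p1`:
the initial state is drawn according to `p1`, the seed uniformly on `[0,1)`. -/
noncomputable def envMeasure (p1 : Γ.K → ℝ) : Measure Γ.Env :=
  (vecMeasure p1).prod (volume.restrict (Set.Ico (0 : ℝ) 1))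

/-- The trajectory: `(Γ.traj σ ω m).1` is the state `k_{m+1}` at stage `m+1` and
`(Γ.traj σ ω m).2` is the history before stage `m+1` (of length `m`), when the
decision-maker uses strategy `σ` and the randomness is `ω`.  At each stage, the pair
(new state, signal) is drawn from `q` via inverse-transform sampling from a fresh
uniform variable. -/
noncomputable def traj (σ : Γ.Strategy) (ω : Γ.Env) : ℕ → Γ.K × Γ.Hist
  | 0 => (ω.1, [])
  | m + 1 =>
    let p := traj σ ω m
    let a := σ p.2
    let y := sampleOn (Γ.q p.1 a) (unif ω.2 m)
    (y.1, p.2 ++ [(a, y.2)])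

/-- The state `k_{m+1}` at stage `m+1` (`m` is 0-indexed). -/
noncomputable def state (σ : Γ.Strategy) (ω : Γ.Env) (m : ℕ) : Γ.K := (Γ.traj σ ω m).1

/-- The history before stage `m+1` (a list of length `m`). -/
noncomputable def hist (σ : Γ.Strategy) (ω : Γ.Env) (m : ℕ) : Γ.Hist := (Γ.traj σ ω m).2

/-- The action `a_{m+1}` played at stage `m+1`. -/
noncomputable def act (σ : Γ.Strategy) (ω : Γ.Env) (m : ℕ) : Γ.A := σ (Γ.hist σ ω m)

/-- The reward `g_{m+1}` obtained at stage `m+1`. -/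
noncomputable def rew (σ : Γ.Strategy) (ω : Γ.Env) (m : ℕ) : ℝ :=
  Γ.g (Γ.state σ ω m) (Γ.act σ ω m)

/-- The average reward over the first `n` stages. -/
noncomputable def avg (σ : Γ.Strategy) (ω : Γ.Env) (n : ℕ) : ℝ :=
  (1 / n : ℝ) * ∑ m ∈ Finset.range n, Γ.rew σ ω m

/-- The probability of an event under initial belief `p1` (the strategy `σ` is recorded for
readability; the underlying measure does not depend on it). -/
noncomputable def prob (p1 : Γ.K → ℝ) (_σ : Γ.Strategy) (E : Set Γ.Env) : ℝ :=
  (Γ.envMeasure p1 E).toReal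

/-- The long-run average payoff `γ^{p1}_∞(σ) = E[liminf (1/n) ∑ g_m]`. -/
noncomputable def pay (p1 : Γ.K → ℝ) (σ : Γ.Strategy) : ℝ :=
  ∫ ω, atTop.liminf (Γ.avg σ ω) ∂(Γ.envMeasure p1)

/-- The payoff starting from a deterministic state `k`, i.e. `γ^k_∞(σ)`. -/
noncomputable def payK (k : Γ.K) (σ : Γ.Strategy) : ℝ := Γ.pay (diracBelief k) σ

/-- The value `v_∞(p1)`. -/
noncomputable def val (p1 : Γ.K → ℝ) : ℝ := ⨆ σ : Γ.Strategy, Γ.pay p1 σ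

/-- A strategy has finite memory if it is implemented by a finite-state transducer. -/
def FiniteMemory (σ : Γ.Strategy) : Prop :=
  ∃ (n : ℕ) (m0 : Fin n) (σa : Fin n → Γ.A) (σu : Fin n → Γ.A × Γ.S → Fin n),
    ∀ h : Γ.Hist, σ h = σa (h.foldl σu m0)

/-- A blind MDP: the signal set is a singleton. -/
def Blind : Prop := Γ.nS = 1

/-- The strategy induced by a sequence of actions `a_1, a_2, …` (`as m` is the action played
at stage `m+1`, regardless of the observed history). -/
def blindStrat (as : ℕ → Γ.A) : Γ.Strategy := fun h => as h.length

end POMDP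

/-- A sequence is eventually periodic if it is periodic with some period `T ≥ 1` from
some stage `N` on. -/
def EventuallyPeriodic {α : Type*} (as : ℕ → α) : Prop :=
  ∃ T ≥ 1, ∃ N ≥ 1, ∀ m ≥ N, as (m + T) = as m


section
open ProbabilityTheory in
noncomputable def lam : Measure ℝ := volume.restrict (Set.Ico (0 : ℝ) 1)

instance : IsProbabilityMeasure lam := by
  constructor; simp [lam]

noncomputable def dig (x : ℝ) (i : ℕ) : Bool := decide (⌊x * 2 ^ (i + 1)⌋ % 2 = 1)

lemma digitR_eq (x : ℝ) (i : ℕ) : digitR x i = if dig x i then 1 else 0 := by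
  simp [digitR, dig]

lemma floor_half (x : ℝ) (n : ℕ) : ⌊x * 2 ^ n⌋ = ⌊x * 2 ^ (n + 1)⌋ / 2 := by
  have := Int.floor_div_natCast (x * 2 ^ (n + 1)) 2
  refine Eq.trans ?_ this
  congr 1
  push_cast
  rw [pow_succ]; ring

def cval (b : ℕ → Bool) : ℕ → ℤ
  | 0 => 0
  | n + 1 => 2 * cval b n + (if b n then 1 else 0)

lemma cyl_eq (b : ℕ → Bool) (n : ℕ) :
    {x : ℝ | x ∈ Set.Ico (0:ℝ) 1 ∧ ∀ i < n, dig x i = b i} = {x | ⌊x * 2 ^ n⌋ = cval b n} := by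
  induction n with
  | zero =>
    ext x
    simp [cval, Int.floor_eq_iff]
  | succ n ih =>
    ext x
    have h1 := Set.ext_iff.1 ih x
    simp only [Set.mem_ofPred_eq] at h1 ⊢
    rw [floor_half] at h1
    have h2 : dig x n = b n ↔ (⌊x * 2 ^ (n + 1)⌋ % 2 = if b n then 1 else 0) := by
      unfold dig
      cases b n <;> simp
    constructor
    · rintro ⟨hx, hi⟩
      have h3 := h1.1 ⟨hx, fun i hi' => hi i (by omega)⟩
      have h4 := h2.1 (hi n (by omega))
      simp only [cval]
      omega
    · intro h
      simp only [cval] at h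
      have h3 : ⌊x * 2 ^ (n + 1)⌋ / 2 = cval b n := by split_ifs at h <;> omega
      have h4 : (⌊x * 2 ^ (n + 1)⌋ % 2 = if b n then 1 else 0) := by split_ifs at h ⊢ <;> omega
      obtain ⟨hx, hi⟩ := h1.2 h3
      refine ⟨hx, fun i hi' => ?_⟩
      rcases Nat.lt_succ_iff_lt_or_eq.1 hi' with h | rfl
      · exact hi i h
      · exact h2.2 h4

lemma measurable_dig (i : ℕ) : Measurable (fun x => dig x i) := by
  unfold dig
  have : Measurable (fun x : ℝ => ⌊x * 2 ^ (i + 1)⌋) := by fun_prop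
  exact (measurable_from_top (f := fun z : ℤ => decide (z % 2 = 1))).comp this

lemma lam_cyl (b : ℕ → Bool) (n : ℕ) : lam {x : ℝ | ∀ i < n, dig x i = b i} = (2⁻¹ : ENNReal) ^ n := by
  have hm : MeasurableSet {x : ℝ | ∀ i < n, dig x i = b i} := by
    have : {x : ℝ | ∀ i < n, dig x i = b i} = ⋂ i, ⋂ (_ : i < n), {x | dig x i = b i} := by
      ext; simp
    rw [this]
    refine MeasurableSet.iInter fun i => MeasurableSet.iInter fun _ => ?_
    exact measurable_dig i (measurableSet_singleton (b i))
  rw [lam, Measure.restrict_apply hm]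
  have : {x : ℝ | ∀ i < n, dig x i = b i} ∩ Set.Ico 0 1
      = Set.Ico ((cval b n : ℝ) / 2 ^ n) ((cval b n + 1 : ℝ) / 2 ^ n) := by
    have h := cyl_eq b n
    have h2 : {x : ℝ | ∀ i < n, dig x i = b i} ∩ Set.Ico 0 1 =
      {x : ℝ | x ∈ Set.Ico (0:ℝ) 1 ∧ ∀ i < n, dig x i = b i} := by
      ext; simp [and_comm]
    rw [h2, h]
    ext x
    simp only [Set.mem_ofPred_eq, Set.mem_Ico, Int.floor_eq_iff]
    rw [div_le_iff₀ (by positivity), lt_div_iff₀ (by positivity)]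
  rw [this, Real.volume_Ico, ← sub_div, add_sub_cancel_left, ENNReal.ofReal_div_of_pos (by positivity)]
  simp [ENNReal.ofReal_pow, ENNReal.inv_pow]

noncomputable def coin : Measure Bool := (2⁻¹ : ENNReal) • Measure.count

instance : IsProbabilityMeasure coin := by
  constructor
  rw [coin, Measure.smul_apply, Measure.count_univ]
  simp only [ENat.card_eq_coe_fintype_card, Fintype.card_bool, smul_eq_mul]
  exact ENNReal.inv_mul_cancel (by simp) (by simp)

lemma map_dig_range (n : ℕ) : lam.map (fun x (i : Fin n) => dig x i) = Measure.pi (fun _ => coin) := by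
  have hm : Measurable (fun x (i : Fin n) => dig x i) := measurable_pi_iff.2 fun i => measurable_dig i
  refine Measure.ext_of_singleton fun b => ?_
  rw [Measure.map_apply hm (measurableSet_singleton b), Measure.pi_singleton]
  have := lam_cyl (fun i => if h : i < n then b ⟨i, h⟩ else false) n
  convert this using 2
  · ext x
    simp only [Set.mem_preimage, Set.mem_singleton_iff, Set.mem_ofPred_eq, funext_iff]
    constructor
    · intro h i hi; simp [hi, h ⟨i, hi⟩]
    · intro h i; simpa using h i i.2
  · simp [coin]

lemma map_dig : lam.map dig = Measure.infinitePi (fun _ => coin) := by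
  have hm : Measurable dig := measurable_pi_iff.2 fun i => measurable_dig i
  refine Measure.eq_infinitePi _ fun s t ht => ?_
  obtain ⟨n, hn⟩ : ∃ n, s ⊆ Finset.range n := ⟨s.sup id + 1, fun i hi => by
    exact Finset.mem_range.2 (Nat.lt_succ_of_le (Finset.le_sup (f := id) hi))⟩
  classical
  let t' : ℕ → Set Bool := fun i => if i ∈ s then t i else Set.univ
  have h1 : (s : Set ℕ).pi t = (fun b (i : Fin n) => b i) ⁻¹' (Set.univ.pi fun i : Fin n => t' i) := by
    ext b
    simp only [Set.mem_pi, Set.mem_preimage, Set.mem_univ, true_imp_iff, t']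
    constructor
    · intro h i; split_ifs with hi
      · exact h i hi
      · trivial
    · intro h i hi
      have := h ⟨i, by simpa using hn hi⟩
      simpa [show i ∈ s from hi] using this
  have hmt : ∀ i, MeasurableSet (t' i) := fun i => by simp only [t']; split_ifs; exacts [ht i, .univ]
  have hr : Measurable (fun (b : ℕ → Bool) (i : Fin n) => b i) := by fun_prop
  rw [h1, ← Measure.map_apply hr (MeasurableSet.univ_pi fun i => hmt i), Measure.map_map hr hm]
  have := map_dig_range n
  change Measure.map (fun x (i : Fin n) => dig x i) lam _ = _
  rw [this, Measure.pi_pi, Fin.prod_univ_eq_prod_range (fun i => coin (t' i)) n]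
  symm
  have : ∏ i ∈ s, coin (t i) = ∏ i ∈ s, coin (t' i) :=
    Finset.prod_congr rfl fun i hi => by simp [t', hi]
  rw [this]
  exact Finset.prod_subset hn fun i _ hi => by
    simp only [t', hi, if_false]; exact measure_univ

noncomputable def binv (b : ℕ → Bool) : ℝ := ∑' j : ℕ, (if b j then (1:ℝ) else 0) / 2 ^ (j + 1)

lemma summable_bin (b : ℕ → Bool) : Summable (fun j : ℕ => (if b j then (1:ℝ) else 0) / 2 ^ (j + 1)) := by
  refine Summable.of_nonneg_of_le (fun j => by split_ifs <;> positivity) (fun j => ?_)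
    (summable_geometric_two)
  have : ((1:ℝ) / 2) ^ j = 2 / 2 ^ (j+1) := by
    rw [one_div, inv_pow, pow_succ]; field_simp
  rw [this]
  gcongr
  split_ifs <;> norm_num

lemma measurable_binv : Measurable binv := by
  unfold binv
  have : ∀ j : ℕ, Measurable (fun b : ℕ → Bool => (if b j then (1:ℝ) else 0) / 2 ^ (j + 1)) := fun j =>
    (measurable_from_top (f := fun z : Bool => (if z then (1:ℝ) else 0) / 2 ^ (j + 1))).comp
      (measurable_pi_apply j)
  refine measurable_of_tendsto_metrizable
    (f := fun n b => ∑ j ∈ Finset.range n, (if b j then (1:ℝ) else 0) / 2 ^ (j + 1))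
    (fun n => Finset.measurable_sum _ fun j _ => this j) ?_
  rw [tendsto_pi_nhds]
  exact fun b => (summable_bin b).hasSum.tendsto_sum_nat

lemma unif_eq (x : ℝ) (m : ℕ) : unif x m = binv (fun j => dig x (Nat.pair m j)) := by
  simp [unif, binv, digitR_eq]

lemma binv_dig {x : ℝ} (hx : x ∈ Set.Ico (0:ℝ) 1) : binv (dig x) = x := by
  have h1 : ∀ n, ∑ j ∈ Finset.range n, (if dig x j then (1:ℝ) else 0) / 2 ^ (j + 1)
      = ⌊x * 2 ^ n⌋ / 2 ^ n := by
    intro n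
    induction n with
    | zero =>
      have : ⌊x⌋ = 0 := Int.floor_eq_iff.2 (by simpa using hx)
      simp [this]
    | succ n ih =>
      rw [Finset.sum_range_succ, ih, floor_half x n]
      have h2 : ⌊x * 2 ^ (n + 1)⌋ = 2 * (⌊x * 2 ^ (n + 1)⌋ / 2) + (if dig x n then 1 else 0) := by
        unfold dig
        by_cases h : ⌊x * 2 ^ (n + 1)⌋ % 2 = 1 <;> simp [h] <;> omega
      set z := ⌊x * 2 ^ (n + 1)⌋ / 2
      rw [h2]
      push_cast
      rw [pow_succ]
      field_simp
  refine tendsto_nhds_unique (summable_bin (dig x)).hasSum.tendsto_sum_nat ?_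
  simp_rw [h1]
  have h3 : Tendsto (fun n : ℕ => x - (1/2:ℝ) ^ n) atTop (nhds x) := by
    simpa using tendsto_const_nhds.sub (tendsto_pow_atTop_nhds_zero_of_lt_one (r := (1/2:ℝ)) (by norm_num) (by norm_num))
  refine tendsto_of_tendsto_of_tendsto_of_le_of_le h3 tendsto_const_nhds (fun n => ?_) (fun n => ?_)
  · simp only [one_div, inv_pow]
    rw [le_div_iff₀ (by positivity), sub_mul, inv_mul_cancel₀ (by positivity)]
    exact (Int.sub_one_lt_floor _).le
  · simp only
    rw [div_le_iff₀ (by positivity)]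
    exact Int.floor_le _

lemma measurable_unif (m : ℕ) : Measurable (fun x => unif x m) := by
  simp_rw [unif_eq]
  exact measurable_binv.comp (measurable_pi_iff.2 fun j => measurable_dig _)

lemma map_binv : (Measure.infinitePi (fun _ : ℕ => coin)).map binv = lam := by
  rw [← map_dig, Measure.map_map measurable_binv (measurable_pi_iff.2 fun i => measurable_dig i)]
  conv_rhs => rw [← Measure.map_id (μ := lam)]
  refine Measure.map_congr ?_
  rw [lam]
  filter_upwards [ae_restrict_mem measurableSet_Ico] with x hx
  exact binv_dig hx

lemma map_unif : lam.map (fun x m => unif x m) = Measure.infinitePi (fun _ : ℕ => lam) := by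
  have hd : Measurable dig := measurable_pi_iff.2 fun i => measurable_dig i
  have h1 : (fun x m => unif x m) =
      (fun (c : ℕ → ℕ → Bool) m => binv (c m)) ∘ (MeasurableEquiv.curry ℕ ℕ Bool)
       ∘ (fun (b : ℕ → Bool) (p : ℕ × ℕ) => b (Nat.pair p.1 p.2)) ∘ dig := by
    ext x m
    simp only [unif_eq, Function.comp_def]; rfl
  rw [h1, ← Measure.map_map, ← Measure.map_map, ← Measure.map_map, map_dig]
  · rw [Measure.map_infinitePi_infinitePi_of_inj (P := fun _ => coin)
      (f := fun p : ℕ × ℕ => Nat.pair p.1 p.2)]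
    · have h2 := Measure.infinitePi_map_curry (fun (_ : ℕ) (_ : ℕ) => coin)
      have h3 := Measure.infinitePi_map_pi (μ := fun _ : ℕ => Measure.infinitePi (fun _ : ℕ => coin))
        (f := fun _ => binv) (fun _ => measurable_binv)
      simp_rw [map_binv] at h3
      rw [← h3, ← h2]
    · intro p q h
      have := Nat.pair_eq_pair.1 h
      exact Prod.ext this.1 this.2
  · fun_prop
  · exact hd
  · fun_prop
  · fun_prop
  · refine measurable_pi_iff.2 fun m => measurable_binv.comp (measurable_pi_apply m)
  · fun_prop

open ProbabilityTheory

lemma map_unif_one (m : ℕ) : lam.map (fun x => unif x m) = lam := by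
  have := congrArg (Measure.map (fun f : ℕ → ℝ => f m)) map_unif
  rw [Measure.infinitePi_map_eval, Measure.map_map (by fun_prop)
    (measurable_pi_iff.2 measurable_unif)] at this
  exact this

lemma iIndep_unif : iIndepFun (fun m x => unif x m) lam := by
  rw [iIndepFun_iff_map_fun_eq_infinitePi_map measurable_unif, map_unif]
  simp_rw [map_unif_one]

end

section
open ProbabilityTheory

lemma measurable_sampleFin {n : ℕ} (hn : 0 < n) (p : Fin n → ℝ) : Measurable (sampleFin hn p) := by
  classical
  let c : Fin n → ℝ := fun y => ∑ z ∈ Finset.univ.filter fun z : Fin n => z ≤ y, p z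
  let Φ : (Fin n → Prop) → Fin n := fun b =>
    let s : Finset (Fin n) := Finset.univ.filter fun y : Fin n => b y
    if hs : s.Nonempty then s.min' hs else ⟨0, hn⟩
  have h1 : sampleFin hn p = Φ ∘ (fun u y => u < c y) := by
    ext u
    simp only [sampleFin, Φ, Function.comp, c]
  rw [h1]
  have h2 : Measurable (fun (u : ℝ) y => u < c y) := measurable_pi_iff.2 fun y =>
    measurable_to_prop (by
      have : (fun u => u < c y) ⁻¹' {True} = Set.Iio (c y) := by ext; simp
      rw [this]; exact measurableSet_Iio)
  exact (Measurable.of_discrete (f := Φ)).comp h2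

lemma sampleFin_iff {n : ℕ} (hn : 0 < n) (p : Fin n → ℝ) (hp : ∀ y, 0 ≤ p y) (hs : ∑ y, p y = 1)
    {u : ℝ} (hu : u ∈ Set.Ico (0:ℝ) 1) (y : Fin n) :
    sampleFin hn p u = y ↔ u ∈ Set.Ico (∑ z ∈ Finset.univ.filter (fun z : Fin n => z < y), p z)
      (∑ z ∈ Finset.univ.filter (fun z : Fin n => z ≤ y), p z) := by
  classical
  have hne : (Finset.univ.filter fun y : Fin n =>
      u < ∑ z ∈ Finset.univ.filter (fun z : Fin n => z ≤ y), p z).Nonempty := by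
    refine ⟨⟨n - 1, by omega⟩, ?_⟩
    simp only [Finset.mem_filter, Finset.mem_univ, true_and]
    have : (Finset.univ.filter fun z : Fin n => z ≤ ⟨n - 1, by omega⟩) = Finset.univ := by
      ext z; simp only [Finset.mem_filter, Finset.mem_univ, true_and, iff_true, Fin.le_def]; omega
    rw [this, hs]; exact hu.2
  have h0 : sampleFin hn p u = Finset.min' _ hne := by
    simp only [sampleFin]
    rw [dif_pos (by convert hne)]
  rw [h0]
  constructor
  · intro h
    have hy := Finset.min'_mem _ hne
    rw [h] at hy
    simp only [Finset.mem_filter, Finset.mem_univ, true_and] at hy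
    refine ⟨?_, hy⟩
    by_contra! hlt
    rcases Nat.eq_zero_or_pos y.1 with h0 | h0
    · have : (Finset.univ.filter fun z : Fin n => z < y) = ∅ := by
        ext z; simp only [Finset.mem_filter, Finset.mem_univ, true_and, Finset.notMem_empty, iff_false, Fin.lt_def]; omega
      rw [this, Finset.sum_empty] at hlt
      linarith [hu.1]
    · let y' : Fin n := ⟨y.1 - 1, by omega⟩
      have h1 : (Finset.univ.filter fun z : Fin n => z < y) = Finset.univ.filter fun z => z ≤ y' := by
        ext z; simp only [Finset.mem_filter, Finset.mem_univ, true_and, Fin.le_def, Fin.lt_def, y']; omega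
      rw [h1] at hlt
      have := Finset.min'_le (Finset.univ.filter fun y : Fin n =>
        u < ∑ z ∈ Finset.univ.filter (fun z : Fin n => z ≤ y), p z) y' (by simpa using hlt)
      rw [h] at this
      simp only [Fin.le_def, y'] at this; omega
  · intro h
    refine le_antisymm (Finset.min'_le _ _ (by simpa using h.2)) ?_
    refine Finset.le_min' _ _ _ fun y' hy' => ?_
    by_contra! hlt
    simp only [Finset.mem_filter, Finset.mem_univ, true_and] at hy'
    have : ∑ z ∈ Finset.univ.filter (fun z : Fin n => z ≤ y'), p z ≤
      ∑ z ∈ Finset.univ.filter (fun z : Fin n => z < y), p z :=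
      Finset.sum_le_sum_of_subset_of_nonneg (by
        intro z; simp; intro hz; exact lt_of_le_of_lt hz hlt) (fun _ _ _ => hp _)
    linarith [h.1]

lemma lam_sampleFin {n : ℕ} (hn : 0 < n) (p : Fin n → ℝ) (hp : ∀ y, 0 ≤ p y) (hs : ∑ y, p y = 1)
    (y : Fin n) : lam.real {u | sampleFin hn p u = y} = p y := by
  set a := (∑ z ∈ Finset.univ.filter (fun z : Fin n => z < y), p z) with ha
  set b := (∑ z ∈ Finset.univ.filter (fun z : Fin n => z ≤ y), p z) with hb
  have ha0 : 0 ≤ a := Finset.sum_nonneg fun _ _ => hp _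
  have hb1 : b ≤ 1 := by
    rw [← hs]; exact Finset.sum_le_sum_of_subset_of_nonneg (by simp) (fun _ _ _ => hp _)
  have hab : b = p y + a := by
    rw [ha, hb, ← Finset.sum_insert (by simp)]
    congr 1; ext z; simp [le_iff_lt_or_eq, or_comm]
  have : {u | sampleFin hn p u = y} ∩ Set.Ico (0:ℝ) 1 = Set.Ico a b := by
    ext u
    constructor
    · rintro ⟨h1, h2⟩; exact (sampleFin_iff hn p hp hs h2 y).1 h1
    · intro h
      have : u ∈ Set.Ico (0:ℝ) 1 := ⟨ha0.trans h.1, h.2.trans_le hb1⟩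
      exact ⟨(sampleFin_iff hn p hp hs this y).2 h, this⟩
  have hm : MeasurableSet {u | sampleFin hn p u = y} :=
    measurable_sampleFin hn p (measurableSet_singleton y)
  rw [measureReal_def, lam, Measure.restrict_apply hm, this, Real.volume_Ico, hab,
    add_sub_cancel_right, ENNReal.toReal_ofReal (hp y)]

section
variable {β : Type*} [Fintype β] [Nonempty β]

lemma measurableSet_sampleOn (p : β → ℝ) (y : β) : MeasurableSet {u | sampleOn p u = y} := by
  have : {u | sampleOn p u = y} = {u | sampleFin Fintype.card_pos
     (fun i => p ((Fintype.equivFin β).symm i)) u = Fintype.equivFin β y} := by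
    ext u; simp only [sampleOn, Set.mem_ofPred_eq, Equiv.symm_apply_eq]
  rw [this]
  exact measurable_sampleFin _ _ (measurableSet_singleton _)

lemma lam_sampleOn (p : β → ℝ) (hp : ∀ y, 0 ≤ p y) (hs : ∑ y, p y = 1) (y : β) :
    lam.real {u | sampleOn p u = y} = p y := by
  have : {u | sampleOn p u = y} = {u | sampleFin Fintype.card_pos
     (fun i => p ((Fintype.equivFin β).symm i)) u = Fintype.equivFin β y} := by
    ext u; simp only [sampleOn, Set.mem_ofPred_eq, Equiv.symm_apply_eq]
  rw [this, lam_sampleFin]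
  · simp
  · exact fun _ => hp _
  · rw [← hs]; exact Equiv.sum_comp (Fintype.equivFin β).symm p
end

/-- sigma-algebra generated by the first `m` uniforms -/
@[reducible] noncomputable def sig (m : ℕ) : MeasurableSpace ℝ :=
  ⨆ i ∈ Set.Iio m, MeasurableSpace.comap (fun x => unif x i) inferInstance

lemma sig_le (m : ℕ) : sig m ≤ (inferInstance : MeasurableSpace ℝ) :=
  iSup₂_le fun i _ => (measurable_unif i).comap_le

lemma sig_mono {m n : ℕ} (h : m ≤ n) : sig m ≤ sig n :=
  biSup_mono fun _ hi => lt_of_lt_of_le hi h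

lemma measurable_unif_sig (m : ℕ) : Measurable[sig (m+1)] (fun x => unif x m) := by
  have : MeasurableSpace.comap (fun x => unif x m) inferInstance ≤ sig (m+1) :=
    le_iSup₂ (f := fun i (_ : i ∈ Set.Iio (m+1)) =>
      MeasurableSpace.comap (fun x => unif x i) inferInstance) m (by simp)
  exact (comap_measurable _).mono this le_rfl

lemma indep_sig (m : ℕ) {F : ℝ → ℝ} (hF : Measurable[sig m] F) {H : ℝ → ℝ} (hH : Measurable H) :
    IndepFun F (fun x => H (unif x m)) lam := by
  have h := indep_iSup_of_disjoint (m := fun i => MeasurableSpace.comap (fun x => unif x i) inferInstance)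
    (fun i => (measurable_unif i).comap_le) iIndep_unif (S := Set.Iio m) (T := {m}) (by simp)
  refine indep_of_indep_of_le_left (indep_of_indep_of_le_right h ?_) hF.comap_le
  simp only [Set.mem_singleton_iff, iSup_iSup_eq_left]
  exact (hH.comp (comap_measurable _)).comap_le

namespace POMDP
variable (Γ : POMDP)

/-- transition operator on functions of (state, history) -/
noncomputable def T (σ : Γ.Strategy) (f : Γ.K × Γ.Hist → ℝ) (x : Γ.K × Γ.Hist) : ℝ :=
  ∑ y, Γ.q x.1 (σ x.2) y * f (y.1, x.2 ++ [(σ x.2, y.2)])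

open Classical in
noncomputable def pre (σ : Γ.Strategy) (f : Γ.K × Γ.Hist → ℝ) (z : Γ.K × Γ.A × (Γ.K × Γ.S))
    (x : Γ.K × Γ.Hist) : ℝ :=
  if x.1 = z.1 ∧ σ x.2 = z.2.1 then f (z.2.2.1, x.2 ++ [(z.2.1, z.2.2.2)]) else 0

open Classical in
noncomputable def ind (z : Γ.K × Γ.A × (Γ.K × Γ.S)) (u : ℝ) : ℝ :=
  if sampleOn (Γ.q z.1 z.2.1) u = z.2.2 then 1 else 0

lemma measurable_ind (z) : Measurable (Γ.ind z) :=
  Measurable.ite (measurableSet_sampleOn _ _) measurable_const measurable_const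

lemma traj_succ_sum (σ : Γ.Strategy) (f : Γ.K × Γ.Hist → ℝ) (ω : Γ.Env) (m : ℕ) :
    f (Γ.traj σ ω (m+1)) = ∑ z, Γ.pre σ f z (Γ.traj σ ω m) * Γ.ind z (unif ω.2 m) := by
  classical
  rw [Finset.sum_eq_single ((Γ.traj σ ω m).1, σ (Γ.traj σ ω m).2,
    sampleOn (Γ.q (Γ.traj σ ω m).1 (σ (Γ.traj σ ω m).2)) (unif ω.2 m))]
  · simp [pre, ind, traj]
  · rintro ⟨k, a, y⟩ - hz
    by_cases h : (Γ.traj σ ω m).1 = k ∧ σ (Γ.traj σ ω m).2 = a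
    · obtain ⟨rfl, rfl⟩ := h
      have : sampleOn (Γ.q (Γ.traj σ ω m).1 (σ (Γ.traj σ ω m).2)) (unif ω.2 m) ≠ y := by
        rintro rfl; exact hz rfl
      simp [ind, this]
    · simp [pre, h]
  · simp

lemma T_sum (σ : Γ.Strategy) (f : Γ.K × Γ.Hist → ℝ) (x : Γ.K × Γ.Hist) :
    Γ.T σ f x = ∑ z, Γ.pre σ f z x * Γ.q z.1 z.2.1 z.2.2 := by
  classical
  rw [Fintype.sum_prod_type, Finset.sum_eq_single x.1 _ (by simp)]
  · rw [Fintype.sum_prod_type, Finset.sum_eq_single (σ x.2) _ (by simp)]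
    · simp [T, pre, mul_comm]
    · intro a _ ha
      refine Finset.sum_eq_zero fun y _ => ?_
      simp [pre, Ne.symm ha]
  · intro k _ hk
    refine Finset.sum_eq_zero fun y _ => ?_
    simp [pre, Ne.symm hk]

lemma measurable_traj (σ : Γ.Strategy) (k : Γ.K) (m : ℕ) (f : Γ.K × Γ.Hist → ℝ) :
    Measurable[sig m] (fun x => f (Γ.traj σ (k, x) m)) := by
  induction m generalizing f with
  | zero =>
    simp only [traj]
    exact @measurable_const _ _ _ (sig 0) _
  | succ m ih =>
    simp_rw [traj_succ_sum]
    refine Finset.measurable_sum _ fun z _ => Measurable.mul ?_ ?_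
    · exact (ih (Γ.pre σ f z)).mono (sig_mono (by omega)) le_rfl
    · exact (Γ.measurable_ind z).comp (measurable_unif_sig m)

lemma measurable_traj' (σ : Γ.Strategy) (k : Γ.K) (m : ℕ) (f : Γ.K × Γ.Hist → ℝ) :
    Measurable (fun x => f (Γ.traj σ (k, x) m)) :=
  (Γ.measurable_traj σ k m f).mono (sig_le m) le_rfl

lemma integral_ind (z) (m : ℕ) : ∫ x, Γ.ind z (unif x m) ∂lam = Γ.q z.1 z.2.1 z.2.2 := by
  have h1 : ∫ x, Γ.ind z (unif x m) ∂lam = ∫ u, Γ.ind z u ∂(lam.map (fun x => unif x m)) :=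
    (integral_map (measurable_unif m).aemeasurable
      (Γ.measurable_ind z).aestronglyMeasurable).symm
  rw [h1, map_unif_one]
  have h2 : Γ.ind z = Set.indicator {u | sampleOn (Γ.q z.1 z.2.1) u = z.2.2} 1 := by
    classical
    ext u; simp [ind, Set.indicator]
  rw [h2, integral_indicator_one (measurableSet_sampleOn _ _)]
  exact lam_sampleOn _ (Γ.q_nonneg _ _) (Γ.q_sum _ _) _

lemma pre_bdd {σ : Γ.Strategy} {f : Γ.K × Γ.Hist → ℝ} {C : ℝ} (hf : ∀ x, |f x| ≤ C) (z x) :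
    |Γ.pre σ f z x| ≤ C := by
  unfold pre; split_ifs
  · exact hf _
  · simpa using (abs_nonneg _).trans (hf x)

lemma integrable_bdd {F : ℝ → ℝ} (hF : Measurable F) {C : ℝ} (hb : ∀ x, |F x| ≤ C) :
    Integrable F lam :=
  Integrable.of_bound hF.aestronglyMeasurable C (ae_of_all _ hb)

/-- Markov property -/
lemma markov (σ : Γ.Strategy) (k : Γ.K) (m : ℕ) {F : ℝ → ℝ} (hF : Measurable[sig m] F) {C : ℝ}
    (hb : ∀ x, |F x| ≤ C) {f : Γ.K × Γ.Hist → ℝ} {C' : ℝ} (hf : ∀ x, |f x| ≤ C') :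
    ∫ x, F x * f (Γ.traj σ (k, x) (m+1)) ∂lam = ∫ x, F x * Γ.T σ f (Γ.traj σ (k, x) m) ∂lam := by
  have hC : 0 ≤ C := (abs_nonneg _).trans (hb 0)
  have hmz : ∀ z, Measurable[sig m] (fun x => F x * Γ.pre σ f z (Γ.traj σ (k, x) m)) := fun z =>
    hF.mul (Γ.measurable_traj σ k m (Γ.pre σ f z))
  have hbz : ∀ z x, |F x * Γ.pre σ f z (Γ.traj σ (k, x) m)| ≤ C * C' := fun z x => by
    rw [abs_mul]; exact mul_le_mul (hb x) (Γ.pre_bdd hf _ _) (abs_nonneg _) hC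
  have hiz : ∀ z, Integrable (fun x => F x * Γ.pre σ f z (Γ.traj σ (k, x) m)) lam := fun z =>
    integrable_bdd ((hmz z).mono (sig_le m) le_rfl) (hbz z)
  have hmi : ∀ z, Measurable (fun x => Γ.ind z (unif x m)) := fun z =>
    (Γ.measurable_ind z).comp (measurable_unif m)
  simp_rw [traj_succ_sum, T_sum, Finset.mul_sum, ← mul_assoc]
  rw [integral_finsetSum, integral_finsetSum]
  · refine Finset.sum_congr rfl fun z _ => ?_
    rw [integral_mul_const, ← Γ.integral_ind z m]
    exact (indep_sig m (hmz z) (Γ.measurable_ind z)).integral_fun_mul_eq_mul_integral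
      (hiz z).aestronglyMeasurable (hmi z).aestronglyMeasurable
  · intro z _; exact (hiz z).mul_const _
  · intro z _
    refine integrable_bdd (C := C * C') (((hmz z).mono (sig_le m) le_rfl).mul (hmi z)) fun x => ?_
    rw [abs_mul]
    have h1 : |Γ.ind z (unif x m)| ≤ 1 := by unfold ind; split_ifs <;> simp
    calc _ ≤ C * C' * 1 := mul_le_mul (hbz z x) h1 (abs_nonneg _) ((abs_nonneg _).trans (hbz z x))
      _ = _ := mul_one _

lemma T_bdd {σ : Γ.Strategy} {f : Γ.K × Γ.Hist → ℝ} {C : ℝ} (hf : ∀ x, |f x| ≤ C) (x) :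
    |Γ.T σ f x| ≤ C := by
  unfold T
  calc _ ≤ ∑ y, |Γ.q x.1 (σ x.2) y * f (y.1, x.2 ++ [(σ x.2, y.2)])| := Finset.abs_sum_le_sum_abs _ _
    _ ≤ ∑ y, Γ.q x.1 (σ x.2) y * C := Finset.sum_le_sum fun y _ => by
      rw [abs_mul, abs_of_nonneg (Γ.q_nonneg _ _ _)]
      exact mul_le_mul_of_nonneg_left (hf _) (Γ.q_nonneg _ _ _)
    _ = C := by rw [← Finset.sum_mul, Γ.q_sum, one_mul]

lemma expect (σ : Γ.Strategy) (k : Γ.K) (m : ℕ) {f : Γ.K × Γ.Hist → ℝ} {C : ℝ} (hf : ∀ x, |f x| ≤ C) :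
    ∫ x, f (Γ.traj σ (k, x) m) ∂lam = (Γ.T σ)^[m] f (k, []) := by
  induction m generalizing f with
  | zero => simp [traj]
  | succ m ih =>
    have := Γ.markov σ k m (F := fun _ => 1) measurable_const (C := 1) (by simp) hf
    simp only [one_mul] at this
    rw [this, ih (Γ.T_bdd hf), Function.iterate_succ_apply]

end POMDP

end

section
open ProbabilityTheory Topology

lemma slln {M : ℕ → ℝ → ℝ} (hM : ∀ n, Measurable (M n)) {C : ℝ} (hb : ∀ n x, |M n x| ≤ C)
    (ho : ∀ i j, i < j → ∫ x, M i x * M j x ∂lam = 0) :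
    ∀ᵐ x ∂lam, Tendsto (fun n : ℕ => (∑ i ∈ Finset.range n, M i x) / n) atTop (𝓝 0) := by
  have hC : 0 ≤ C := (abs_nonneg _).trans (hb 0 0)
  set S : ℕ → ℝ → ℝ := fun n x => ∑ i ∈ Finset.range n, M i x with hS
  have hSm : ∀ n, Measurable (S n) := fun n => Finset.measurable_sum _ fun i _ => hM i
  have hSb : ∀ n x, |S n x| ≤ n * C := fun n x => by
    calc _ ≤ ∑ i ∈ Finset.range n, |M i x| := Finset.abs_sum_le_sum_abs _ _
      _ ≤ ∑ i ∈ Finset.range n, C := Finset.sum_le_sum fun i _ => hb i x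
      _ = _ := by simp
  have hint : ∀ i j, Integrable (fun x => M i x * M j x) lam := fun i j =>
    POMDP.integrable_bdd (C := C * C) ((hM i).mul (hM j)) fun x => by
      rw [abs_mul]; exact mul_le_mul (hb _ _) (hb _ _) (abs_nonneg _) hC
  have hSint : ∀ n, Integrable (fun x => S n x ^ 2) lam := fun n =>
    POMDP.integrable_bdd (C := (n * C)^2) ((hSm n).pow_const 2) fun x => by
      rw [abs_pow]; exact pow_le_pow_left₀ (abs_nonneg _) (hSb n x) 2
  have hSM : ∀ n, ∫ x, S n x * M n x ∂lam = 0 := fun n => by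
    simp only [hS, Finset.sum_mul]
    rw [integral_finsetSum _ (fun i _ => hint i n)]
    exact Finset.sum_eq_zero fun i hi => ho i n (Finset.mem_range.1 hi)
  have hS2 : ∀ n, ∫ x, S n x ^ 2 ∂lam ≤ n * C ^ 2 := by
    intro n
    induction n with
    | zero => simp [hS]
    | succ n ih =>
      have h1 : ∀ x, S (n+1) x ^ 2 = S n x ^ 2 + 2 * (S n x * M n x) + M n x * M n x := fun x => by
        simp only [hS, Finset.sum_range_succ]; ring
      simp_rw [h1]
      have hi2 : Integrable (fun x => 2 * (S n x * M n x)) lam :=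
        (POMDP.integrable_bdd (C := n * C * C) ((hSm n).mul (hM n)) fun x => by
          show |S n x * M n x| ≤ _
          rw [abs_mul]; exact mul_le_mul (hSb _ _) (hb _ _) (abs_nonneg _) (by positivity)).const_mul 2
      have hi3 : Integrable (fun x => S n x^2 + 2*(S n x * M n x)) lam := (hSint n).add hi2
      rw [integral_add hi3 (hint n n), integral_add (hSint n) hi2,
        integral_const_mul, hSM]
      have h3 : ∫ x, M n x * M n x ∂lam ≤ C ^ 2 := by
        calc _ ≤ ∫ x, C ^ 2 ∂lam := integral_mono (hint n n) (integrable_const _) fun x => by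
              have := abs_le.1 (hb n x)
              simp only; nlinarith
          _ = _ := by simp
      push_cast; linarith
  -- along squares
  have hY : ∀ᵐ x ∂lam, Tendsto (fun n : ℕ => S ((n+1)^2) x / ((n+1:ℕ)^2 : ℝ)) atTop (𝓝 0) := by
    have hYm : ∀ n : ℕ, Measurable (fun x => (S ((n+1)^2) x / ((n+1:ℕ)^2 : ℝ))^2) := fun n =>
      ((hSm _).div_const _).pow_const 2
    have h1 : ∀ n : ℕ, ∫⁻ x, ENNReal.ofReal ((S ((n+1)^2) x / ((n+1:ℕ)^2 : ℝ))^2) ∂lam ≤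
        ENNReal.ofReal (C ^ 2 * (1 / (n+1:ℕ)^2)) := fun n => by
      rw [← ofReal_integral_eq_lintegral_ofReal]
      · apply ENNReal.ofReal_le_ofReal
        simp_rw [div_pow]
        rw [integral_div, div_le_iff₀ (by positivity)]
        refine (hS2 _).trans (le_of_eq ?_)
        push_cast; field_simp
      · simp_rw [div_pow]; exact (hSint _).div_const _
      · exact ae_of_all _ fun x => by positivity
    have h2 : ∑' n : ℕ, ENNReal.ofReal (C ^ 2 * (1 / (n+1:ℕ)^2)) ≠ ⊤ := by
      have : Summable (fun n : ℕ => C ^ 2 * (1 / ((n+1:ℕ):ℝ)^2)) :=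
        ((summable_nat_add_iff 1).2 (Real.summable_one_div_nat_pow.2 (by norm_num : 1 < 2))).mul_left _
      exact this.tsum_ofReal_ne_top
    have h3 : ∫⁻ x, ∑' n : ℕ, ENNReal.ofReal ((S ((n+1)^2) x / ((n+1:ℕ)^2 : ℝ))^2) ∂lam ≠ ⊤ := by
      rw [lintegral_tsum fun n => (hYm n).ennreal_ofReal.aemeasurable]
      exact ne_top_of_le_ne_top h2 (ENNReal.tsum_le_tsum h1)
    filter_upwards [ae_lt_top (Measurable.tsum fun n => (hYm n).ennreal_ofReal) h3] with x hx
    have h4 := ENNReal.tendsto_atTop_zero_of_tsum_ne_top hx.ne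
    have h5 := (ENNReal.tendsto_toReal ENNReal.zero_ne_top).comp h4
    simp only [Function.comp_def, ENNReal.toReal_zero] at h5
    have h6 := (Real.continuous_sqrt.tendsto 0).comp h5
    rw [Real.sqrt_zero] at h6
    rw [tendsto_zero_iff_abs_tendsto_zero]
    refine h6.congr fun n => ?_
    simp only [Function.comp]
    rw [ENNReal.toReal_ofReal (by positivity), Real.sqrt_sq_eq_abs]
  filter_upwards [hY] with x hx
  have hx' : Tendsto (fun n : ℕ => S (n^2) x / (n^2 : ℝ)) atTop (𝓝 0) := by
    rw [← tendsto_add_atTop_iff_nat 1]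
    exact_mod_cast hx
  have hsq : Tendsto (fun N : ℕ => Nat.sqrt N) atTop atTop := by
    refine tendsto_atTop_atTop.2 fun b => ⟨b * b, fun N hN => Nat.le_sqrt.2 hN⟩
  have h7 : Tendsto (fun n : ℕ => |S (n^2) x / (n^2 : ℝ)| + 2 * C / n) atTop (𝓝 0) := by
    have := hx'.abs.add (tendsto_const_div_atTop_nhds_zero_nat (2 * C))
    simpa using this
  refine squeeze_zero_norm' ?_ (h7.comp hsq)
  filter_upwards [eventually_ge_atTop 1] with N hN
  simp only [Function.comp, Real.norm_eq_abs]
  set n := Nat.sqrt N with hn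
  have hn1 : 1 ≤ n := Nat.le_sqrt.2 (by omega)
  have hnN : n ^ 2 ≤ N := by rw [pow_two]; exact Nat.sqrt_le N
  have hNn : N ≤ n ^ 2 + 2 * n := by have := Nat.sqrt_le_add N; rw [← hn] at this; nlinarith
  have hdiff : |S N x| ≤ |S (n^2) x| + 2 * n * C := by
    have : S N x = S (n^2) x + ∑ i ∈ Finset.Ico (n^2) N, M i x := by
      simp only [hS]; rw [Finset.sum_range_add_sum_Ico _ hnN]
    rw [this]
    refine (abs_add_le _ _).trans (add_le_add_right ?_ _)
    calc _ ≤ ∑ i ∈ Finset.Ico (n^2) N, |M i x| := Finset.abs_sum_le_sum_abs _ _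
      _ ≤ ∑ i ∈ Finset.Ico (n^2) N, C := Finset.sum_le_sum fun i _ => hb i x
      _ = (N - n^2 : ℕ) * C := by simp
      _ ≤ _ := by
        gcongr
        have : N - n^2 ≤ 2 * n := by omega
        exact_mod_cast this
  have hn1' : (1:ℝ) ≤ n := by exact_mod_cast hn1
  have hnN' : (n:ℝ)^2 ≤ N := by exact_mod_cast hnN
  rw [abs_div, Nat.abs_cast]
  calc |S N x| / N ≤ (|S (n^2) x| + 2 * n * C) / N := by gcongr
    _ ≤ (|S (n^2) x| + 2 * n * C) / (n:ℝ)^2 := by gcongr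
    _ = _ := by rw [add_div, abs_div, abs_of_nonneg (by positivity : (0:ℝ) ≤ n^2)]; field_simp

namespace POMDP
variable (Γ : POMDP)

lemma avg_nonneg (σ : Γ.Strategy) (ω n) : 0 ≤ Γ.avg σ ω n :=
  mul_nonneg (by positivity) (Finset.sum_nonneg fun _ _ => Γ.g_nonneg _ _)

lemma avg_le_one (σ : Γ.Strategy) (ω n) : Γ.avg σ ω n ≤ 1 := by
  unfold avg
  rcases Nat.eq_zero_or_pos n with rfl | hn
  · simp
  rw [one_div, inv_mul_le_iff₀ (by positivity)]
  calc _ ≤ ∑ m ∈ Finset.range n, (1:ℝ) := Finset.sum_le_sum fun _ _ => Γ.g_le_one _ _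
    _ = _ := by simp

lemma bdd_ge (σ : Γ.Strategy) (ω) : IsBoundedUnder (· ≥ ·) atTop (Γ.avg σ ω) :=
  isBoundedUnder_of ⟨0, fun n => Γ.avg_nonneg σ ω n⟩

lemma bdd_le (σ : Γ.Strategy) (ω) : IsBoundedUnder (· ≤ ·) atTop (Γ.avg σ ω) :=
  isBoundedUnder_of ⟨1, fun n => Γ.avg_le_one σ ω n⟩

lemma L_nonneg (σ : Γ.Strategy) (ω) : 0 ≤ atTop.liminf (Γ.avg σ ω) :=
  le_liminf_of_le (Γ.bdd_le σ ω).isCoboundedUnder_ge (Eventually.of_forall fun n => Γ.avg_nonneg σ ω n)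

lemma L_le_one (σ : Γ.Strategy) (ω) : atTop.liminf (Γ.avg σ ω) ≤ 1 :=
  liminf_le_of_le (Γ.bdd_ge σ ω) (fun b hb => by
    obtain ⟨n, hn⟩ := hb.exists
    exact hn.trans (Γ.avg_le_one σ ω n))

lemma L_abs (σ : Γ.Strategy) (ω) : |atTop.liminf (Γ.avg σ ω)| ≤ 1 := by
  rw [abs_of_nonneg (Γ.L_nonneg σ ω)]; exact Γ.L_le_one σ ω

/-- reward as a function of (state, history) -/
noncomputable def gh (σ : Γ.Strategy) (x : Γ.K × Γ.Hist) : ℝ := Γ.g x.1 (σ x.2)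

lemma gh_abs (σ : Γ.Strategy) (x) : |Γ.gh σ x| ≤ 1 := by
  unfold gh
  rw [abs_of_nonneg (Γ.g_nonneg _ _)]; exact Γ.g_le_one _ _

lemma rew_eq (σ : Γ.Strategy) (ω m) : Γ.rew σ ω m = Γ.gh σ (Γ.traj σ ω m) := rfl

lemma measurable_avg (σ : Γ.Strategy) (k : Γ.K) (n) : Measurable (fun x => Γ.avg σ (k, x) n) := by
  unfold avg
  simp_rw [rew_eq]
  exact (Finset.measurable_sum _ fun m _ => Γ.measurable_traj' σ k m (Γ.gh σ)).const_mul _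

lemma measurable_L (σ : Γ.Strategy) (k : Γ.K) : Measurable (fun x => atTop.liminf (Γ.avg σ (k, x))) :=
  Measurable.liminf (fun n => Γ.measurable_avg σ k n)

noncomputable def payk (σ : Γ.Strategy) (k : Γ.K) : ℝ := ∫ x, atTop.liminf (Γ.avg σ (k, x)) ∂lam

lemma payk_nonneg (σ : Γ.Strategy) (k : Γ.K) : 0 ≤ Γ.payk σ k :=
  integral_nonneg fun _ => Γ.L_nonneg _ _

lemma pay_eq (p : Γ.K → ℝ) (hp : IsBelief p) (σ : Γ.Strategy) :
    Γ.pay p σ = ∑ k, p k * Γ.payk σ k := by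
  have hfin : IsFiniteMeasure (vecMeasure p) := by
    constructor
    simp [vecMeasure]
  have hm : Measurable (fun ω : Γ.Env => atTop.liminf (Γ.avg σ ω)) :=
    measurable_from_prod_countable_right fun k => Γ.measurable_L σ k
  unfold pay envMeasure
  change ∫ ω, _ ∂(vecMeasure p).prod lam = _
  rw [integral_prod _ (Integrable.of_bound hm.aestronglyMeasurable 1
    (ae_of_all _ fun ω => Γ.L_abs σ ω))]
  change ∫ k, Γ.payk σ k ∂(vecMeasure p) = _
  unfold vecMeasure
  rw [integral_finsetSum_measure]
  · refine Finset.sum_congr rfl fun k _ => ?_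
    rw [integral_smul_measure, integral_dirac, ENNReal.toReal_ofReal (hp.1 k), smul_eq_mul]
  · intro k _
    exact (integrable_dirac (by simp)).smul_measure (by simp)

lemma hist_len (σ : Γ.Strategy) (ω m) : (Γ.traj σ ω m).2.length = m := by
  induction m with
  | zero => simp [traj]
  | succ m ih => simp [traj, ih]

lemma ae_pos : ∀ᵐ x ∂lam, ∀ m k a, 0 < Γ.q k a (sampleOn (Γ.q k a) (unif x m)) := by
  have h : ∀ m (z : Γ.K × Γ.A × (Γ.K × Γ.S)), ∀ᵐ x ∂lam, Γ.q z.1 z.2.1 z.2.2 = 0 →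
      Γ.ind z (unif x m) = 0 := by
    intro m z
    by_cases hz : Γ.q z.1 z.2.1 z.2.2 = 0
    · have h1 := Γ.integral_ind z m
      rw [hz] at h1
      have h0 : ∀ x, 0 ≤ Γ.ind z (unif x m) := fun x => by unfold ind; split_ifs <;> simp
      have h2 := (integral_eq_zero_iff_of_nonneg h0 (integrable_bdd (C := 1)
        ((Γ.measurable_ind z).comp (measurable_unif m)) fun x => by
          show |Γ.ind z (unif x m)| ≤ 1; unfold ind; split_ifs <;> simp)).1 h1
      filter_upwards [h2] with x hx _ using hx
    · exact ae_of_all _ fun x hx => absurd hx hz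
  filter_upwards [ae_all_iff.2 fun m => ae_all_iff.2 fun z => h m z] with x hx m k a
  refine lt_of_le_of_ne (Γ.q_nonneg _ _ _) fun h0 => ?_
  have := hx m (k, a, sampleOn (Γ.q k a) (unif x m)) h0.symm
  simp [ind] at this

lemma guarantee_k (τ : Γ.Strategy) (m0 : ℕ) (V c : Γ.K × Γ.Hist → ℝ) (C : ℝ) (hV : ∀ x, |V x| ≤ C)
    (hmono : ∀ x : Γ.K × Γ.Hist, m0 ≤ x.2.length → ∀ y, 0 < Γ.q x.1 (τ x.2) y →
      c x ≤ c (y.1, x.2 ++ [(τ x.2, y.2)]))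
    (hpoi : ∀ x : Γ.K × Γ.Hist, m0 ≤ x.2.length → V x + c x ≤ Γ.gh τ x + Γ.T τ V x)
    (k : Γ.K) :
    ∀ᵐ x ∂lam, c (Γ.traj τ (k, x) m0) ≤ atTop.liminf (Γ.avg τ (k, x)) := by
  set M : ℕ → ℝ → ℝ := fun m x => V (Γ.traj τ (k, x) (m+1)) - Γ.T τ V (Γ.traj τ (k, x) m) with hM
  have hMs : ∀ m, Measurable[sig (m+1)] (M m) := fun m =>
    (Γ.measurable_traj τ k (m+1) V).sub
      ((Γ.measurable_traj τ k m (Γ.T τ V)).mono (sig_mono (by omega)) le_rfl)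
  have hMm : ∀ m, Measurable (M m) := fun m => (hMs m).mono (sig_le _) le_rfl
  have hMb : ∀ m x, |M m x| ≤ C + C := fun m x =>
    (abs_sub _ _).trans (add_le_add (hV _) (Γ.T_bdd hV _))
  have hC : 0 ≤ C := (abs_nonneg _).trans (hV (k, []))
  have ho : ∀ i j, i < j → ∫ x, M i x * M j x ∂lam = 0 := by
    intro i j hij
    have hs : Measurable[sig j] (M i) := (hMs i).mono (sig_mono hij) le_rfl
    have := Γ.markov τ k j hs (hMb i) hV
    simp only [hM, mul_sub] at this ⊢
    rw [integral_sub, this, sub_self]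
    · refine integrable_bdd (C := (C + C) * C) ((hMm i).mul (Γ.measurable_traj' τ k (j+1) V)) fun x => ?_
      rw [abs_mul]; exact mul_le_mul (hMb i x) (hV _) (abs_nonneg _) (by positivity)
    · refine integrable_bdd (C := (C + C) * C) ((hMm i).mul (Γ.measurable_traj' τ k j (Γ.T τ V))) fun x => ?_
      rw [abs_mul]; exact mul_le_mul (hMb i x) (Γ.T_bdd hV _) (abs_nonneg _) (by positivity)
  filter_upwards [slln hMm hMb ho, Γ.ae_pos] with x hx hpos
  set X := fun m => Γ.traj τ (k, x) m with hX
  set S := fun n => ∑ i ∈ Finset.range n, M i x with hS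
  have key : ∀ n, c (X m0) ≤ c (X (m0 + n)) ∧
      n * c (X m0) + V (X m0) - V (X (m0 + n)) + S (m0 + n) - S m0 ≤
        ∑ m ∈ Finset.range (m0 + n), Γ.gh τ (X m) := by
    intro n
    induction n with
    | zero =>
      refine ⟨le_rfl, ?_⟩
      have := Finset.sum_nonneg (f := fun m => Γ.gh τ (X m)) (s := Finset.range m0) fun m _ => Γ.g_nonneg _ _
      simpa using this
    | succ n ih =>
      have hl : m0 ≤ (X (m0 + n)).2.length := by simp [hX, hist_len]
      constructor
      · refine ih.1.trans ?_
        exact hmono (X (m0 + n)) hl _ (hpos (m0 + n) _ _)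
      · have h1 := hpoi (X (m0 + n)) hl
        have h2 : S (m0 + n + 1) = S (m0 + n) + (V (X (m0 + n + 1)) - Γ.T τ V (X (m0 + n))) := by
          simp only [hS, Finset.sum_range_succ]; rfl
        have h4 := ih.1
        have h5 := ih.2
        rw [← add_assoc, h2, Finset.sum_range_succ]
        push_cast
        linarith
  set cs := c (X m0)
  let w : ℕ → ℝ := fun n => cs + (-(m0 * cs) - 2 * C - S m0) / n + S n / n
  have hw : Tendsto w atTop (𝓝 cs) := by
    have := (tendsto_const_nhds (x := cs)).add (tendsto_const_div_atTop_nhds_zero_nat (-(m0 * cs) - 2 * C - S m0))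
    simpa using this.add hx
  have hle : ∀ᶠ n in atTop, w n ≤ Γ.avg τ (k, x) n := by
    filter_upwards [eventually_ge_atTop (m0 + 1)] with n hn
    obtain ⟨j, rfl⟩ := Nat.exists_eq_add_of_le (show m0 ≤ n by omega)
    have h1 := (key j).2
    have h2 := abs_le.1 (hV (X m0))
    have h3 := abs_le.1 (hV (X (m0 + j)))
    have hp : (0:ℝ) < ((m0 + j : ℕ) : ℝ) := by exact_mod_cast (by omega)
    simp only [w, avg]
    rw [one_div, ← div_eq_inv_mul, le_div_iff₀ hp, add_mul, add_mul, div_mul_cancel₀ _ hp.ne',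
      div_mul_cancel₀ _ hp.ne']
    refine le_trans ?_ h1
    push_cast
    linarith
  rw [← hw.liminf_eq]
  exact liminf_le_liminf hle hw.isBoundedUnder_ge (Γ.bdd_le τ (k, x)).isCoboundedUnder_ge

lemma guarantee (τ : Γ.Strategy) (m0 : ℕ) (V c : Γ.K × Γ.Hist → ℝ) (C : ℝ) (hV : ∀ x, |V x| ≤ C)
    (hc : ∀ x, |c x| ≤ C)
    (hmono : ∀ x : Γ.K × Γ.Hist, m0 ≤ x.2.length → ∀ y, 0 < Γ.q x.1 (τ x.2) y →
      c x ≤ c (y.1, x.2 ++ [(τ x.2, y.2)]))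
    (hpoi : ∀ x : Γ.K × Γ.Hist, m0 ≤ x.2.length → V x + c x ≤ Γ.gh τ x + Γ.T τ V x)
    (p : Γ.K → ℝ) (hp : IsBelief p) :
    ∑ k, p k * (∫ x, c (Γ.traj τ (k, x) m0) ∂lam) ≤ Γ.pay p τ := by
  rw [Γ.pay_eq p hp]
  refine Finset.sum_le_sum fun k _ => mul_le_mul_of_nonneg_left ?_ (hp.1 k)
  exact integral_mono_ae (integrable_bdd (Γ.measurable_traj' τ k m0 c) fun x => hc _)
    (integrable_bdd (Γ.measurable_L τ k) fun x => Γ.L_abs _ _)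
    (Γ.guarantee_k τ m0 V c C hV hmono hpoi k)

lemma payk_le (σ : Γ.Strategy) (k : Γ.K) {δ : ℝ} (hδ : 0 < δ) :
    ∀ᶠ n : ℕ in atTop, Γ.payk σ k - δ ≤
      (1 / n : ℝ) * ∑ m ∈ Finset.range n, (Γ.T σ)^[m] (Γ.gh σ) (k, []) := by
  have h1 : Tendsto (fun n => ∫ x, min (Γ.avg σ (k, x) n) (atTop.liminf (Γ.avg σ (k, x))) ∂lam) atTop
      (𝓝 (Γ.payk σ k)) := by
    refine tendsto_integral_of_dominated_convergence (fun _ => 1) (fun n =>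
      ((Γ.measurable_avg σ k n).min (Γ.measurable_L σ k)).aestronglyMeasurable)
      (integrable_const _) (fun n => ae_of_all _ fun x => ?_) (ae_of_all _ fun x => ?_)
    · rw [Real.norm_eq_abs, abs_of_nonneg (le_min (Γ.avg_nonneg _ _ _) (Γ.L_nonneg _ _))]
      exact (min_le_left _ _).trans (Γ.avg_le_one _ _ _)
    · rw [tendsto_order]
      constructor
      · intro a ha
        filter_upwards [eventually_lt_of_lt_liminf ha (Γ.bdd_ge σ (k, x))] with n hn
        exact lt_min hn ha
      · intro a ha
        exact Eventually.of_forall fun n => lt_of_le_of_lt (min_le_right _ _) ha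
  filter_upwards [(tendsto_order.1 h1).1 (Γ.payk σ k - δ) (by linarith)] with n hn
  refine hn.le.trans ?_
  calc _ ≤ ∫ x, Γ.avg σ (k, x) n ∂lam := by
        refine integral_mono (integrable_bdd (C := 1) ((Γ.measurable_avg σ k n).min (Γ.measurable_L σ k)) fun x => ?_)
          (integrable_bdd (C := 1) (Γ.measurable_avg σ k n) fun x => ?_) fun x => min_le_left _ _
        · rw [abs_of_nonneg (le_min (Γ.avg_nonneg _ _ _) (Γ.L_nonneg _ _))]
          exact (min_le_left _ _).trans (Γ.avg_le_one _ _ _)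
        · rw [abs_of_nonneg (Γ.avg_nonneg _ _ _)]; exact Γ.avg_le_one _ _ _
    _ = _ := by
      unfold avg
      simp_rw [rew_eq]
      rw [integral_const_mul, integral_finsetSum]
      · congr 1
        exact Finset.sum_congr rfl fun m _ => Γ.expect σ k m (Γ.gh_abs σ)
      · intro m _
        exact integrable_bdd (Γ.measurable_traj' σ k m _) fun x => Γ.gh_abs _ _

end POMDP

end

section
open ProbabilityTheory Topology
namespace POMDP
variable (Γ : POMDP)

/-- state-and-continuation-strategy space -/
abbrev XS := Γ.K × Γ.Strategy

/-- one-step transition -/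
def th (y : Γ.K × Γ.S) (x : Γ.XS) : Γ.XS := (y.1, fun h => x.2 ((x.2 [], y.2) :: h))
/-- transition weight -/
def w (y : Γ.K × Γ.S) (x : Γ.XS) : ℝ := Γ.q x.1 (x.2 []) y
/-- Markov operator -/
noncomputable def P (f : Γ.XS → ℝ) (x : Γ.XS) : ℝ := ∑ y, Γ.w y x * f (Γ.th y x)
/-- reward -/
def g0 (x : Γ.XS) : ℝ := Γ.g x.1 (x.2 [])

lemma w_nonneg (y x) : 0 ≤ Γ.w y x := Γ.q_nonneg _ _ _
lemma w_sum (x) : ∑ y, Γ.w y x = 1 := Γ.q_sum _ _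

lemma cont_fin (F : Γ.K → Γ.A → ℝ) : Continuous (fun x : Γ.XS => F x.1 (x.2 [])) := by
  have : Continuous (fun z : Γ.K × Γ.A => F z.1 z.2) := continuous_of_discreteTopology
  exact this.comp (continuous_fst.prodMk ((continuous_apply ([] : Γ.Hist)).comp continuous_snd))

lemma cont_w (y) : Continuous (Γ.w y) := Γ.cont_fin fun k a => Γ.q k a y
lemma cont_g0 : Continuous Γ.g0 := Γ.cont_fin Γ.g

lemma cont_th (y) : Continuous (Γ.th y) := by
  refine continuous_const.prodMk (continuous_pi fun h => ?_)
  have : Continuous (fun z : Γ.A × Γ.Strategy => z.2 ((z.1, y.2) :: h)) :=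
    continuous_prod_of_discrete_left.2 fun a => continuous_apply (A := fun _ : Γ.Hist => Γ.A) ((a, y.2) :: h)
  have h2 : Continuous (fun x : Γ.XS => ((x.2 [], x.2) : Γ.A × Γ.Strategy)) :=
    ((continuous_apply (A := fun _ : Γ.Hist => Γ.A) ([] : Γ.Hist)).comp continuous_snd).prodMk continuous_snd
  exact this.comp h2

lemma cont_P {f : Γ.XS → ℝ} (hf : Continuous f) : Continuous (Γ.P f) :=
  continuous_finsetSum _ fun y _ => (Γ.cont_w y).mul (hf.comp (Γ.cont_th y))

lemma meas_P {f : Γ.XS → ℝ} (hf : Measurable f) : Measurable (Γ.P f) :=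
  Finset.measurable_sum _ fun y _ => (Γ.cont_w y).measurable.mul (hf.comp (Γ.cont_th y).measurable)

lemma P_mono {f f' : Γ.XS → ℝ} (h : ∀ x, f x ≤ f' x) (x) : Γ.P f x ≤ Γ.P f' x :=
  Finset.sum_le_sum fun y _ => mul_le_mul_of_nonneg_left (h _) (Γ.w_nonneg y x)

lemma P_const (c : ℝ) (x) : Γ.P (fun _ => c) x = c := by
  simp [P, ← Finset.sum_mul, w_sum]

lemma P_Icc {f : Γ.XS → ℝ} {a b : ℝ} (h : ∀ x, f x ∈ Set.Icc a b) (x) : Γ.P f x ∈ Set.Icc a b := by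
  constructor
  · rw [← Γ.P_const a x]; exact Γ.P_mono (fun x => (h x).1) x
  · rw [← Γ.P_const b x]; exact Γ.P_mono (fun x => (h x).2) x

lemma Pit_Icc {f : Γ.XS → ℝ} {a b : ℝ} (h : ∀ x, f x ∈ Set.Icc a b) (m x) :
    Γ.P^[m] f x ∈ Set.Icc a b := by
  induction m generalizing x with
  | zero => exact h x
  | succ m ih => rw [Function.iterate_succ_apply']; exact Γ.P_Icc ih x

lemma Pit_cont {f : Γ.XS → ℝ} (hf : Continuous f) (m) : Continuous (Γ.P^[m] f) := by
  induction m with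
  | zero => exact hf
  | succ m ih => rw [Function.iterate_succ_apply']; exact Γ.cont_P ih

lemma Pit_meas {f : Γ.XS → ℝ} (hf : Measurable f) (m) : Measurable (Γ.P^[m] f) := by
  induction m with
  | zero => exact hf
  | succ m ih => rw [Function.iterate_succ_apply']; exact Γ.meas_P ih

lemma g0_Icc (x) : Γ.g0 x ∈ Set.Icc (0:ℝ) 1 := ⟨Γ.g_nonneg _ _, Γ.g_le_one _ _⟩

/-- dual operator on measures -/
noncomputable def Pm (μ : Measure Γ.XS) : Measure Γ.XS :=
  ∑ y, (μ.withDensity fun x => ENNReal.ofReal (Γ.w y x)).map (Γ.th y)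

lemma meas_ow (y) : Measurable (fun x => ENNReal.ofReal (Γ.w y x)) :=
  (Γ.cont_w y).measurable.ennreal_ofReal

lemma lintegral_Pm (μ : Measure Γ.XS) {F : Γ.XS → ENNReal} (hF : Measurable F) :
    ∫⁻ x, F x ∂(Γ.Pm μ) = ∫⁻ x, ∑ y, ENNReal.ofReal (Γ.w y x) * F (Γ.th y x) ∂μ := by
  unfold Pm
  rw [lintegral_finsetSum_measure, lintegral_finsetSum']
  · refine Finset.sum_congr rfl fun y _ => ?_
    rw [lintegral_map hF (Γ.cont_th y).measurable,
      lintegral_withDensity_eq_lintegral_mul (g := fun x => F (Γ.th y x)) _ (Γ.meas_ow y)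
        (hF.comp (Γ.cont_th y).measurable)]
    rfl
  · intro y _
    exact ((Γ.meas_ow y).mul (hF.comp (Γ.cont_th y).measurable)).aemeasurable

instance prob_Pm (μ : Measure Γ.XS) [IsProbabilityMeasure μ] : IsProbabilityMeasure (Γ.Pm μ) := by
  constructor
  have := Γ.lintegral_Pm μ (F := fun _ => 1) measurable_const
  simp only [lintegral_const, one_mul, mul_one] at this
  rw [this]
  have h : ∀ x, ∑ y, ENNReal.ofReal (Γ.w y x) = 1 := fun x => by
    rw [← ENNReal.ofReal_sum_of_nonneg fun y _ => Γ.w_nonneg y x, w_sum, ENNReal.ofReal_one]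
  simp [h]

lemma integrable_of_Icc (μ : Measure Γ.XS) [IsFiniteMeasure μ] {f : Γ.XS → ℝ} (hf : Measurable f) {a b : ℝ}
    (h : ∀ x, f x ∈ Set.Icc a b) : Integrable f μ :=
  Integrable.of_mem_Icc a b hf.aemeasurable (ae_of_all _ h)

lemma integral_Pm (μ : Measure Γ.XS) [IsProbabilityMeasure μ] {f : Γ.XS → ℝ} (hf : Measurable f) {a b : ℝ}
    (h : ∀ x, f x ∈ Set.Icc a b) : ∫ x, f x ∂(Γ.Pm μ) = ∫ x, Γ.P f x ∂μ := by
  have hint : Integrable f (Γ.Pm μ) := Γ.integrable_of_Icc _ hf h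
  have hle : ∀ y, (μ.withDensity fun x => ENNReal.ofReal (Γ.w y x)).map (Γ.th y) ≤ Γ.Pm μ := fun y =>
    Finset.single_le_sum (f := fun y => (μ.withDensity fun x => ENNReal.ofReal (Γ.w y x)).map (Γ.th y))
      (fun _ _ => Measure.zero_le _) (Finset.mem_univ y)
  have hw : ∀ y, ∫ x, f x ∂((μ.withDensity fun x => ENNReal.ofReal (Γ.w y x)).map (Γ.th y)) =
      ∫ x, Γ.w y x * f (Γ.th y x) ∂μ := fun y => by
    rw [integral_map (Γ.cont_th y).measurable.aemeasurable hf.aestronglyMeasurable,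
      integral_withDensity_eq_integral_toReal_smul (Γ.meas_ow y) (ae_of_all _ fun _ => ENNReal.ofReal_lt_top)]
    simp only [ENNReal.toReal_ofReal (Γ.w_nonneg y _), smul_eq_mul]
  unfold Pm P
  rw [integral_finsetSum_measure fun y _ => hint.mono_measure (hle y), integral_finsetSum]
  · exact Finset.sum_congr rfl fun y _ => hw y
  · intro y _
    have h1 : ∀ x, ‖Γ.w y x‖ ≤ 1 := fun x => by
      rw [Real.norm_eq_abs, abs_of_nonneg (Γ.w_nonneg y x), ← Γ.w_sum x]
      exact Finset.single_le_sum (fun y _ => Γ.w_nonneg y x) (Finset.mem_univ y)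
    exact (Γ.integrable_of_Icc μ (hf.comp (Γ.cont_th y).measurable) fun x => h _).bdd_mul
      (Γ.cont_w y).measurable.aestronglyMeasurable (ae_of_all _ h1)

lemma ae_Pm {μ : Measure Γ.XS} (hμ : Γ.Pm μ = μ) {p : Γ.XS → Prop} (h : ∀ᵐ x ∂μ, p x) :
    ∀ᵐ x ∂μ, ∀ y, 0 < Γ.w y x → p (Γ.th y x) := by
  rw [← hμ, Pm, ← Measure.sum_fintype, Measure.ae_sum_iff] at h
  refine ae_all_iff.2 fun y => ?_
  have h1 := ae_of_ae_map (Γ.cont_th y).measurable.aemeasurable (h y)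
  rw [ae_withDensity_iff (Γ.meas_ow y)] at h1
  filter_upwards [h1] with x hx hw
  exact hx (by simpa using hw)

/-- law of the process at time `m` -/
noncomputable def law (p : Γ.K → ℝ) (σ : Γ.Strategy) (m : ℕ) : Measure Γ.XS :=
  (Γ.Pm)^[m] ((vecMeasure p).map fun k => (k, σ))

lemma prob_law {p : Γ.K → ℝ} (hp : IsBelief p) (σ m) : IsProbabilityMeasure (Γ.law p σ m) := by
  induction m with
  | zero =>
    have : IsProbabilityMeasure (vecMeasure p) := by
      constructor
      simp only [vecMeasure, Measure.coe_finsetSum, Finset.sum_apply, Measure.smul_apply, measure_univ,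
        smul_eq_mul, mul_one]
      rw [← ENNReal.ofReal_sum_of_nonneg fun y _ => hp.1 y, hp.2, ENNReal.ofReal_one]
    exact Measure.isProbabilityMeasure_map (Measurable.of_discrete).aemeasurable
  | succ m ih => unfold law at ih ⊢; rw [Function.iterate_succ_apply']; infer_instance

lemma integral_law {p : Γ.K → ℝ} (hp : IsBelief p) (σ m) {f : Γ.XS → ℝ} (hf : Measurable f) {a b : ℝ}
    (h : ∀ x, f x ∈ Set.Icc a b) : ∫ x, f x ∂(Γ.law p σ m) = ∑ k, p k * Γ.P^[m] f (k, σ) := by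
  induction m generalizing f with
  | zero =>
    simp only [law, Function.iterate_zero, id]
    rw [integral_map (Measurable.of_discrete).aemeasurable hf.aestronglyMeasurable]
    unfold vecMeasure
    rw [integral_finsetSum_measure]
    · refine Finset.sum_congr rfl fun k _ => ?_
      rw [integral_smul_measure, integral_dirac, ENNReal.toReal_ofReal (hp.1 k), smul_eq_mul]
    · intro k _
      exact (integrable_dirac (by simp)).smul_measure (by simp)
  | succ m ih =>
    have := Γ.prob_law hp σ m
    have h2 : Γ.law p σ (m+1) = Γ.Pm (Γ.law p σ m) := by
      unfold law; rw [Function.iterate_succ_apply']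
    rw [h2, Γ.integral_Pm _ hf h, ih (Γ.meas_P hf) (Γ.P_Icc h)]
    simp only [Function.iterate_succ_apply]

lemma cont_bdd {f : Γ.XS → ℝ} (hf : Continuous f) : ∃ a b, ∀ x, f x ∈ Set.Icc a b := by
  obtain ⟨a, ha⟩ := (isCompact_range hf).bddBelow
  obtain ⟨b, hb⟩ := (isCompact_range hf).bddAbove
  exact ⟨a, b, fun x => ⟨ha ⟨x, rfl⟩, hb ⟨x, rfl⟩⟩⟩

/-- averaged functional -/
noncomputable def Lam (p : Γ.K → ℝ) (σ : Γ.Strategy) (n : ℕ) (f : Γ.XS → ℝ) : ℝ :=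
  (1 / n : ℝ) * ∑ m ∈ Finset.range n, ∑ k, p k * Γ.P^[m] f (k, σ)

lemma exists_measure {p : Γ.K → ℝ} (hp : IsBelief p) (σ : Γ.Strategy) :
    ∃ μ : Measure Γ.XS, IsProbabilityMeasure μ ∧ Γ.Pm μ = μ ∧
      ∀ f : Γ.XS → ℝ, Continuous f →
        Tendsto (fun n => Γ.Lam p σ n f) (hyperfilter ℕ) (𝓝 (∫ x, f x ∂μ)) := by
  have hpl := Γ.prob_law hp σ
  let ν : ℕ → Measure Γ.XS := fun n => ((n + 1 : ℕ) : ENNReal)⁻¹ • ∑ m ∈ Finset.range (n+1), Γ.law p σ m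
  have hν : ∀ n, IsProbabilityMeasure (ν n) := fun n => by
    constructor
    simp only [ν, Measure.smul_apply, Measure.coe_finsetSum, Finset.sum_apply, measure_univ,
      Finset.sum_const, Finset.card_range, smul_eq_mul, nsmul_eq_mul, mul_one]
    exact ENNReal.inv_mul_cancel (by simp) (by simp)
  have hνi : ∀ n (f : Γ.XS → ℝ), Continuous f → ∫ x, f x ∂(ν n) = Γ.Lam p σ (n+1) f := by
    intro n f hf
    obtain ⟨a, b, hab⟩ := Γ.cont_bdd hf
    simp only [ν]
    rw [integral_smul_measure, integral_finsetSum_measure]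
    · simp only [Γ.integral_law hp σ _ hf.measurable hab, Lam]
      rw [ENNReal.toReal_inv, ENNReal.toReal_natCast, smul_eq_mul, one_div]
    · intro m _
      exact Γ.integrable_of_Icc _ hf.measurable hab
  let ν' : ℕ → ProbabilityMeasure Γ.XS := fun n => ⟨ν (n - 1), hν _⟩
  obtain ⟨μ, -, hμ⟩ := isCompact_univ.ultrafilter_le_nhds ((hyperfilter ℕ).map ν') (by simp)
  have hμ' : Tendsto ν' (hyperfilter ℕ) (𝓝 μ) := hμ
  rw [ProbabilityMeasure.tendsto_iff_forall_integral_tendsto] at hμ'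
  have hge : ∀ᶠ n in (hyperfilter ℕ : Filter ℕ), 1 ≤ n :=
    (Nat.hyperfilter_le_atTop) (eventually_ge_atTop 1)
  have hlim : ∀ f : Γ.XS → ℝ, Continuous f →
        Tendsto (fun n => Γ.Lam p σ n f) (hyperfilter ℕ) (𝓝 (∫ x, f x ∂(μ : Measure Γ.XS))) := by
    intro f hf
    have := hμ' (BoundedContinuousFunction.mkOfCompact ⟨f, hf⟩)
    refine this.congr' ?_
    filter_upwards [hge] with n hn
    have := hνi (n-1) f hf
    rw [Nat.sub_add_cancel hn] at this
    simpa [ν'] using this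
  refine ⟨μ, inferInstance, ?_, hlim⟩
  refine ext_of_forall_integral_eq_of_IsFiniteMeasure fun f => ?_
  obtain ⟨a, b, hab⟩ := Γ.cont_bdd f.continuous
  rw [Γ.integral_Pm _ f.continuous.measurable hab]
  have h1 := (hlim _ (Γ.cont_P f.continuous)).sub (hlim _ f.continuous)
  have h2 : Tendsto (fun n => Γ.Lam p σ n (Γ.P f) - Γ.Lam p σ n f) atTop (𝓝 0) := by
    have h3 : ∀ n, Γ.Lam p σ n (Γ.P f) - Γ.Lam p σ n f =
        (1 / n : ℝ) * ((∑ k, p k * Γ.P^[n] f (k, σ)) - ∑ k, p k * f (k, σ)) := by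
      intro n
      simp only [Lam]
      rw [← mul_sub, ← Finset.sum_sub_distrib]
      congr 1
      have := Finset.sum_range_sub (fun m => ∑ k, p k * Γ.P^[m] f (k, σ)) n
      simp only [Function.iterate_zero, id] at this
      rw [← this]
      rfl
    have hb : ∀ n, |(∑ k, p k * Γ.P^[n] f (k, σ)) - ∑ k, p k * f (k, σ)| ≤ b - a := by
      intro n
      rw [← Finset.sum_sub_distrib]
      refine (Finset.abs_sum_le_sum_abs _ _).trans ?_
      calc _ ≤ ∑ k, p k * (b - a) := Finset.sum_le_sum fun k _ => by
            rw [← mul_sub, abs_mul, abs_of_nonneg (hp.1 k)]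
            refine mul_le_mul_of_nonneg_left ?_ (hp.1 k)
            have h4 := Γ.Pit_Icc hab n (k, σ)
            have h5 := hab (k, σ)
            rw [abs_le]; constructor <;> linarith [h4.1, h4.2, h5.1, h5.2]
        _ = b - a := by rw [← Finset.sum_mul, hp.2, one_mul]
    refine squeeze_zero_norm (fun n => ?_) (tendsto_const_div_atTop_nhds_zero_nat (b - a))
    rw [h3, norm_mul, Real.norm_eq_abs, Real.norm_eq_abs, abs_of_nonneg (by positivity), one_div, div_eq_inv_mul]
    exact mul_le_mul_of_nonneg_left (hb n) (by positivity)
  have := tendsto_nhds_unique h1 (h2.mono_left Nat.hyperfilter_le_atTop)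
  linarith

end POMDP

end

section
open ProbabilityTheory Topology
namespace POMDP
variable (Γ : POMDP)

lemma P_congr_ae {μ : Measure Γ.XS} (hμ : Γ.Pm μ = μ) {f f' : Γ.XS → ℝ} (h : f =ᵐ[μ] f') :
    Γ.P f =ᵐ[μ] Γ.P f' := by
  filter_upwards [Γ.ae_Pm hμ h] with x hx
  refine Finset.sum_congr rfl fun y _ => ?_
  rcases (Γ.w_nonneg y x).eq_or_lt with h0 | h0
  · rw [← h0]; simp
  · rw [hx y h0]

lemma P_sq_le (f : Γ.XS → ℝ) (x) :
    ‖Γ.P f x‖ₑ ^ 2 ≤ ∑ y, ENNReal.ofReal (Γ.w y x) * ‖f (Γ.th y x)‖ₑ ^ 2 := by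
  have h1 := Real.pow_arith_mean_le_arith_mean_pow_of_even Finset.univ (fun y => Γ.w y x)
    (fun y => f (Γ.th y x)) (fun y _ => Γ.w_nonneg y x) (Γ.w_sum x) (n := 2) (by decide)
  have h2 : ∀ z : ℝ, ‖z‖ₑ ^ 2 = ENNReal.ofReal (z ^ 2) := fun z => by
    rw [← ofReal_norm, ← ENNReal.ofReal_pow (norm_nonneg _), Real.norm_eq_abs, sq_abs]
  simp only [h2]
  simp only [← ENNReal.ofReal_mul (Γ.w_nonneg _ x)]
  rw [← ENNReal.ofReal_sum_of_nonneg fun y _ => mul_nonneg (Γ.w_nonneg y x) (sq_nonneg _)]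
  exact ENNReal.ofReal_le_ofReal h1

lemma eLpNorm_P {μ : Measure Γ.XS} (hμ : Γ.Pm μ = μ) {f : Γ.XS → ℝ} (hf : Measurable f) :
    eLpNorm (Γ.P f) 2 μ ≤ eLpNorm f 2 μ := by
  rw [eLpNorm_eq_lintegral_rpow_enorm_toReal (by simp) (by simp),
    eLpNorm_eq_lintegral_rpow_enorm_toReal (by simp) (by simp)]
  apply ENNReal.rpow_le_rpow _ (by simp)
  simp only [ENNReal.toReal_ofNat, ENNReal.rpow_ofNat]
  calc _ ≤ ∫⁻ x, ∑ y, ENNReal.ofReal (Γ.w y x) * ‖f (Γ.th y x)‖ₑ ^ 2 ∂μ :=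
        lintegral_mono fun x => Γ.P_sq_le f x
    _ = ∫⁻ x, ‖f x‖ₑ ^ 2 ∂(Γ.Pm μ) := (Γ.lintegral_Pm μ (hf.enorm.pow_const 2)).symm
    _ = _ := by rw [hμ]

lemma memLp_P {μ : Measure Γ.XS} (hμ : Γ.Pm μ = μ) {f : Γ.XS → ℝ} (hf : Measurable f)
    (h : MemLp f 2 μ) : MemLp (Γ.P f) 2 μ :=
  ⟨(Γ.meas_P hf).aestronglyMeasurable, (Γ.eLpNorm_P hμ hf).trans_lt h.2⟩

lemma exists_U {μ : Measure Γ.XS} (hμ : Γ.Pm μ = μ) :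
    ∃ U : Lp ℝ 2 μ →L[ℝ] Lp ℝ 2 μ, ‖U‖ ≤ 1 ∧ ∀ f : Lp ℝ 2 μ, U f =ᵐ[μ] Γ.P f := by
  have hm : ∀ f : Lp ℝ 2 μ, Measurable f := fun f => (Lp.stronglyMeasurable f).measurable
  have hP : ∀ f : Lp ℝ 2 μ, MemLp (Γ.P f) 2 μ := fun f => Γ.memLp_P hμ (hm f) (Lp.memLp f)
  let L : Lp ℝ 2 μ →ₗ[ℝ] Lp ℝ 2 μ :=
    { toFun := fun f => (hP f).toLp
      map_add' := fun f f' => by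
        refine Lp.ext ?_
        filter_upwards [(hP (f+f')).coeFn_toLp, (hP f).coeFn_toLp, (hP f').coeFn_toLp,
          Γ.P_congr_ae hμ (Lp.coeFn_add f f'), Lp.coeFn_add (hP f).toLp (hP f').toLp] with x h1 h2 h3 h4 h5
        rw [h1, h4, h5, Pi.add_apply, h2, h3]
        simp [P, mul_add, Finset.sum_add_distrib]
      map_smul' := fun c f => by
        refine Lp.ext ?_
        filter_upwards [(hP (c • f)).coeFn_toLp, (hP f).coeFn_toLp,
          Γ.P_congr_ae hμ (Lp.coeFn_smul c f), Lp.coeFn_smul c (hP f).toLp] with x h1 h2 h4 h5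
        simp only [RingHom.id_apply]
        rw [h1, h4, h5, Pi.smul_apply, h2]
        simp only [P, Pi.smul_apply, smul_eq_mul, Finset.mul_sum]
        exact Finset.sum_congr rfl fun y _ => by ring }
  refine ⟨L.mkContinuous 1 fun f => ?_, LinearMap.mkContinuous_norm_le _ zero_le_one _, fun f => ?_⟩
  · rw [one_mul]
    show ‖(hP f).toLp‖ ≤ _
    rw [Lp.norm_toLp, Lp.norm_def]
    exact ENNReal.toReal_mono (Lp.memLp f).2.ne (Γ.eLpNorm_P hμ (hm f))
  · exact (hP f).coeFn_toLp

/-- ergodic averages -/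
noncomputable def Av (n : ℕ) (x : Γ.XS) : ℝ := (1 / n : ℝ) * ∑ m ∈ Finset.range n, Γ.P^[m] Γ.g0 x

lemma Av_Icc (n x) : Γ.Av n x ∈ Set.Icc (0:ℝ) 1 := by
  have h := fun m => Γ.Pit_Icc Γ.g0_Icc m x
  unfold Av
  refine ⟨mul_nonneg (by positivity) (Finset.sum_nonneg fun m _ => (h m).1), ?_⟩
  rcases Nat.eq_zero_or_pos n with rfl | hn
  · simp
  rw [one_div, inv_mul_le_iff₀ (by positivity)]
  calc _ ≤ ∑ m ∈ Finset.range n, (1:ℝ) := Finset.sum_le_sum fun m _ => (h m).2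
    _ = _ := by simp

lemma meas_Av (n) : Measurable (Γ.Av n) :=
  (Finset.measurable_sum _ fun m _ => Γ.Pit_meas Γ.cont_g0.measurable m).const_mul _

lemma integral_Av {μ : Measure Γ.XS} [IsProbabilityMeasure μ] (hμ : Γ.Pm μ = μ) {n : ℕ} (hn : 1 ≤ n) :
    ∫ x, Γ.Av n x ∂μ = ∫ x, Γ.g0 x ∂μ := by
  have h : ∀ m, ∫ x, Γ.P^[m] Γ.g0 x ∂μ = ∫ x, Γ.g0 x ∂μ := by
    intro m
    induction m with
    | zero => rfl
    | succ m ih =>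
      rw [Function.iterate_succ_apply', ← ih,
        ← Γ.integral_Pm μ (Γ.Pit_meas Γ.cont_g0.measurable m) (Γ.Pit_Icc Γ.g0_Icc m), hμ]
  unfold Av
  rw [integral_const_mul, integral_finsetSum]
  · simp only [h, Finset.sum_const, Finset.card_range, nsmul_eq_mul]
    field_simp
  · intro m _
    exact Γ.integrable_of_Icc _ (Γ.Pit_meas Γ.cont_g0.measurable m) (Γ.Pit_Icc Γ.g0_Icc m)

lemma ergodic0 {μ : Measure Γ.XS} [IsProbabilityMeasure μ] (hμ : Γ.Pm μ = μ) :
    ∃ (b : Γ.XS → ℝ) (ns : ℕ → ℕ), Measurable b ∧ (∀ x, b x ∈ Set.Icc (0:ℝ) 1) ∧ StrictMono ns ∧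
      (∀ᵐ x ∂μ, Tendsto (fun j => Γ.Av (ns j) x) atTop (𝓝 (b x))) ∧ Γ.P b =ᵐ[μ] b := by
  obtain ⟨U, hU1, hU⟩ := Γ.exists_U hμ
  have hg : MemLp Γ.g0 2 μ := MemLp.of_bound Γ.cont_g0.measurable.aestronglyMeasurable 1
    (ae_of_all _ fun x => by
      rw [Real.norm_eq_abs, abs_of_nonneg (Γ.g0_Icc x).1]; exact (Γ.g0_Icc x).2)
  set g := hg.toLp
  have hit : ∀ m, (U^[m] g : Lp ℝ 2 μ) =ᵐ[μ] Γ.P^[m] Γ.g0 := by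
    intro m
    induction m with
    | zero => exact hg.coeFn_toLp
    | succ m ih =>
      simp only [Function.iterate_succ_apply']
      exact (hU _).trans (Γ.P_congr_ae hμ ih)
  have hB : ∀ n, (birkhoffAverage ℝ U id n g : Lp ℝ 2 μ) =ᵐ[μ] Γ.Av n := by
    intro n
    have h1 : ∀ s : Finset ℕ, ((∑ m ∈ s, U^[m] g : Lp ℝ 2 μ) : Γ.XS → ℝ) =ᵐ[μ]
        fun x => ∑ m ∈ s, Γ.P^[m] Γ.g0 x := by
      intro s
      induction s using Finset.induction_on with
      | empty => simp only [Finset.sum_empty]; exact Lp.coeFn_zero ℝ 2 μ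
      | insert a s ha ih =>
        simp only [Finset.sum_insert ha]
        filter_upwards [Lp.coeFn_add (U^[a] g) (∑ m ∈ s, U^[m] g), ih, hit a] with x h1 h2 h3
        rw [h1, Pi.add_apply, h2, h3]
    simp only [birkhoffAverage, birkhoffSum, id]
    filter_upwards [Lp.coeFn_smul ((n:ℝ)⁻¹) (∑ m ∈ Finset.range n, U^[m] g), h1 (Finset.range n)] with x h2 h3
    rw [h2, Pi.smul_apply, h3, Av, one_div, smul_eq_mul]
  have hT := U.tendsto_birkhoffAverage_orthogonalProjection hU1 g
  set gb : Lp ℝ 2 μ := (((U : Lp ℝ 2 μ →ₗ[ℝ] Lp ℝ 2 μ).eqLocus ↑(1 : Lp ℝ 2 μ →L[ℝ] Lp ℝ 2 μ)).orthogonalProjectionOnto g : Lp ℝ 2 μ) with hgb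
  have hfix : U gb = gb := by
    have := (((U : Lp ℝ 2 μ →ₗ[ℝ] Lp ℝ 2 μ).eqLocus ↑(1 : Lp ℝ 2 μ →L[ℝ] Lp ℝ 2 μ)).orthogonalProjectionOnto g).2
    exact this
  obtain ⟨ns, hns, hae⟩ := (tendstoInMeasure_of_tendsto_Lp hT).exists_seq_tendsto_ae
  have hae2 : ∀ᵐ x ∂μ, Tendsto (fun j => Γ.Av (ns j) x) atTop (𝓝 (gb x)) := by
    filter_upwards [hae, ae_all_iff.2 hB] with x hx hx2
    refine hx.congr fun j => hx2 _
  let b : Γ.XS → ℝ := fun x => limsup (fun j => Γ.Av (ns j) x) atTop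
  have hbg : b =ᵐ[μ] gb := by
    filter_upwards [hae2] with x hx using hx.limsup_eq
  refine ⟨b, ns, Measurable.limsup fun j => Γ.meas_Av _, fun x => ?_, hns, ?_, ?_⟩
  · have hbu : IsBoundedUnder (· ≤ ·) atTop (fun j => Γ.Av (ns j) x) := isBoundedUnder_of ⟨1, fun j => (Γ.Av_Icc _ x).2⟩
    have hbl : IsBoundedUnder (· ≥ ·) atTop (fun j => Γ.Av (ns j) x) := isBoundedUnder_of ⟨0, fun j => (Γ.Av_Icc _ x).1⟩
    exact ⟨le_limsup_of_frequently_le (Frequently.of_forall fun j => (Γ.Av_Icc _ x).1) hbu,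
      limsup_le_of_le hbl.isCoboundedUnder_le (Eventually.of_forall fun j => (Γ.Av_Icc _ x).2)⟩
  · filter_upwards [hae2, hbg] with x hx hx2
    rw [hx2]; exact hx
  · refine (Γ.P_congr_ae hμ hbg).trans ((hU gb).symm.trans ?_)
    rw [hfix]; exact hbg.symm

lemma ergodic {μ : Measure Γ.XS} [IsProbabilityMeasure μ] (hμ : Γ.Pm μ = μ) :
    ∃ (b : Γ.XS → ℝ) (ns : ℕ → ℕ) (G : Set Γ.XS), Measurable b ∧ (∀ x, b x ∈ Set.Icc (0:ℝ) 1) ∧ StrictMono ns ∧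
      MeasurableSet G ∧ (∀ᵐ x ∂μ, x ∈ G) ∧
      (∀ x ∈ G, ∀ y, 0 < Γ.w y x → Γ.th y x ∈ G ∧ b (Γ.th y x) = b x) ∧
      (∀ x ∈ G, Tendsto (fun j => Γ.Av (ns j) x) atTop (𝓝 (b x))) ∧
      ∫ x, b x ∂μ = ∫ x, Γ.g0 x ∂μ := by
  obtain ⟨b, ns, hb, hbI, hns, hlim, hfix⟩ := Γ.ergodic0 hμ
  have hbi : Integrable b μ := Γ.integrable_of_Icc μ hb hbI
  -- invariance along transitions
  have hinv : ∀ᵐ x ∂μ, ∀ y, 0 < Γ.w y x → b (Γ.th y x) = b x := by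
    let b2 : Γ.XS → ℝ := fun x => b x ^ 2
    have hb2 : Measurable b2 := hb.pow_const 2
    have hb2I : ∀ x, b2 x ∈ Set.Icc (0:ℝ) 1 := fun x =>
      ⟨sq_nonneg _, pow_le_one₀ (hbI x).1 (hbI x).2⟩
    let D : Γ.XS → ℝ := fun x => ∑ y, Γ.w y x * (b (Γ.th y x) - b x) ^ 2
    have hD : ∀ x, D x = Γ.P b2 x - 2 * b x * Γ.P b x + b2 x := by
      intro x
      have h1 : b2 x = ∑ y, Γ.w y x * b x ^ 2 := by rw [← Finset.sum_mul, w_sum, one_mul]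
      rw [h1]
      simp only [D, P, Finset.mul_sum, ← Finset.sum_sub_distrib, ← Finset.sum_add_distrib, b2]
      exact Finset.sum_congr rfl fun y _ => by ring
    have hD0 : ∀ x, 0 ≤ D x := fun x => Finset.sum_nonneg fun y _ => mul_nonneg (Γ.w_nonneg y x) (sq_nonneg _)
    have hDae : D =ᵐ[μ] fun x => Γ.P b2 x - b2 x := by
      filter_upwards [hfix] with x hx
      rw [hD, hx]; simp only [b2]; ring
    have i1 : Integrable (Γ.P b2) μ := Γ.integrable_of_Icc μ (Γ.meas_P hb2) (Γ.P_Icc hb2I)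
    have i2 : Integrable b2 μ := Γ.integrable_of_Icc μ hb2 hb2I
    have hDi : Integrable D μ := (i1.sub i2).congr hDae.symm
    have hz : ∫ x, D x ∂μ = 0 := by
      rw [integral_congr_ae hDae, integral_sub i1 i2, ← Γ.integral_Pm μ hb2 hb2I, hμ, sub_self]
    filter_upwards [(integral_eq_zero_iff_of_nonneg hD0 hDi).1 hz] with x hx y hy
    have h1 := (Finset.sum_eq_zero_iff_of_nonneg (fun y _ => mul_nonneg (Γ.w_nonneg y x)
      (sq_nonneg (b (Γ.th y x) - b x)))).1 hx y (Finset.mem_univ _)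
    have h2 : (b (Γ.th y x) - b x) ^ 2 = 0 := by
      rcases mul_eq_zero.1 h1 with h | h
      · exact absurd h hy.ne'
      · exact h
    have := pow_eq_zero_iff (two_ne_zero) |>.1 h2
    linarith
  -- good sets
  let G0 : Set Γ.XS := {x | Tendsto (fun j => Γ.Av (ns j) x) atTop (𝓝 (b x))} ∩
    ⋂ y, ({x | 0 < Γ.w y x}ᶜ ∪ {x | b (Γ.th y x) = b x})
  have hpm : ∀ y, MeasurableSet {x | 0 < Γ.w y x} := fun y =>
    measurableSet_lt measurable_const (Γ.cont_w y).measurable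
  have hG0m : MeasurableSet G0 := by
    refine (measurableSet_tendsto_fun (fun j => Γ.meas_Av _) hb).inter (MeasurableSet.iInter fun y =>
      (hpm y).compl.union (measurableSet_eq_fun (hb.comp (Γ.cont_th y).measurable) hb))
  have hG0 : ∀ᵐ x ∂μ, x ∈ G0 := by
    filter_upwards [hlim, hinv] with x h1 h2
    refine ⟨h1, Set.mem_iInter.2 fun y => ?_⟩
    by_cases hy : 0 < Γ.w y x
    · exact Or.inr (h2 y hy)
    · exact Or.inl hy
  let step : Set Γ.XS → Set Γ.XS := fun B => B ∩ ⋂ y, ({x | 0 < Γ.w y x}ᶜ ∪ (Γ.th y) ⁻¹' B)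
  have hst : ∀ n, MeasurableSet (step^[n] G0) ∧ ∀ᵐ x ∂μ, x ∈ step^[n] G0 := by
    intro n
    induction n with
    | zero => exact ⟨hG0m, hG0⟩
    | succ n ih =>
      rw [Function.iterate_succ_apply']
      refine ⟨ih.1.inter (MeasurableSet.iInter fun y => (hpm y).compl.union ((Γ.cont_th y).measurable ih.1)), ?_⟩
      filter_upwards [ih.2, Γ.ae_Pm hμ ih.2] with x h1 h2
      refine ⟨h1, Set.mem_iInter.2 fun y => ?_⟩
      by_cases hy : 0 < Γ.w y x
      · exact Or.inr (h2 y hy)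
      · exact Or.inl hy
  refine ⟨b, ns, ⋂ n, step^[n] G0, hb, hbI, hns, MeasurableSet.iInter fun n => (hst n).1, ?_, ?_, ?_, ?_⟩
  · filter_upwards [ae_all_iff.2 fun n => (hst n).2] with x hx using Set.mem_iInter.2 hx
  · intro x hx y hy
    rw [Set.mem_iInter] at hx
    refine ⟨Set.mem_iInter.2 fun n => ?_, ?_⟩
    · have := hx (n+1)
      rw [Function.iterate_succ_apply'] at this
      rcases Set.mem_iInter.1 this.2 y with h | h
      · exact absurd hy h
      · exact h
    · rcases Set.mem_iInter.1 (hx 0).2 y with h | h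
      · exact absurd hy h
      · exact h
  · intro x hx
    exact (Set.mem_iInter.1 hx 0).1
  · have h1 : Tendsto (fun j => ∫ x, Γ.Av (ns j) x ∂μ) atTop (𝓝 (∫ x, b x ∂μ)) := by
      refine tendsto_integral_of_dominated_convergence (fun _ => 1)
        (fun n => (Γ.meas_Av _).aestronglyMeasurable) (integrable_const _) (fun n => ae_of_all _ fun x => ?_) hlim
      rw [Real.norm_eq_abs, abs_of_nonneg (Γ.Av_Icc _ x).1]; exact (Γ.Av_Icc _ x).2
    refine tendsto_nhds_unique h1 (tendsto_const_nhds.congr' ?_)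
    filter_upwards [eventually_ge_atTop 1] with j hj
    exact (Γ.integral_Av hμ (hj.trans (hns.id_le j))).symm

end POMDP

end

section
open ProbabilityTheory Topology
namespace POMDP
variable (Γ : POMDP)

lemma fm_of {M : Type*} (φ : Γ.Hist → M) (u : M → Γ.A × Γ.S → M) (a : M → Γ.A)
    (τ : Γ.Strategy) (hfin : (Set.range φ).Finite) (hφ : ∀ h y, φ (h ++ [y]) = u (φ h) y)
    (hτ : ∀ h, τ h = a (φ h)) : Γ.FiniteMemory τ := by
  have : Finite (Set.range φ) := hfin
  obtain ⟨n, ⟨e⟩⟩ := Finite.exists_equiv_fin (Set.range φ)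
  let u' : Set.range φ → Γ.A × Γ.S → Set.range φ := fun m y => ⟨u m.1 y, by
    obtain ⟨h, hh⟩ := m.2
    exact ⟨h ++ [y], by rw [hφ, hh]⟩⟩
  let su : Fin n → Γ.A × Γ.S → Fin n := fun i y => e (u' (e.symm i) y)
  let i0 : Fin n := e ⟨φ [], [], rfl⟩
  refine ⟨n, i0, fun i => a (e.symm i).1, su, fun h => ?_⟩
  have key : ∀ h, h.foldl su i0 = e ⟨φ h, h, rfl⟩ := by
    intro h
    induction h using List.reverseRecOn with
    | nil => rfl
    | append_singleton h y ih =>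
      rw [List.foldl_append, ih]
      simp only [List.foldl_cons, List.foldl_nil, su, Equiv.symm_apply_apply, u']
      congr 2
      exact (hφ h y).symm
  rw [key, hτ]; simp

/-- potential-function certificate -/
def Cert (τ : Γ.Strategy) (c0 : Γ.K → ℝ) : Prop :=
  ∃ (V c : Γ.K × Γ.Hist → ℝ) (C : ℝ), (∀ x, |V x| ≤ C) ∧ (∀ x, |c x| ≤ C) ∧
    (∀ x : Γ.K × Γ.Hist, ∀ y, 0 < Γ.q x.1 (τ x.2) y → c x ≤ c (y.1, x.2 ++ [(τ x.2, y.2)])) ∧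
    (∀ x : Γ.K × Γ.Hist, V x + c x ≤ Γ.gh τ x + Γ.T τ V x) ∧ ∀ k, c0 k ≤ c (k, [])

/-- partial sums -/
noncomputable def St (t : ℕ) (x : Γ.XS) : ℝ := ∑ m ∈ Finset.range t, Γ.P^[m] Γ.g0 x

lemma St_succ (t x) : Γ.St (t+1) x = Γ.g0 x + Γ.P (Γ.St t) x := by
  unfold St
  rw [Finset.sum_range_succ']
  simp only [Function.iterate_zero, id, Function.iterate_succ_apply']
  rw [add_comm]
  congr 1
  simp only [P, Finset.mul_sum]
  rw [Finset.sum_comm]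

lemma St_Icc (t : ℕ) (x) : Γ.St t x ∈ Set.Icc (0:ℝ) t := by
  have h := fun m => Γ.Pit_Icc Γ.g0_Icc m x
  refine ⟨Finset.sum_nonneg fun m _ => (h m).1, ?_⟩
  calc _ ≤ ∑ m ∈ Finset.range t, (1:ℝ) := Finset.sum_le_sum fun m _ => (h m).2
    _ = _ := by simp

section comb
variable {Γ}
variable (b : Γ.XS → ℝ) (G : Set Γ.XS) (val : Γ.K → ℝ)

/-- compatibility of labels and strategy -/
def Compat (β : Γ.K → Option Γ.K) (σ : Γ.Strategy) : Prop :=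
  ∀ k c, β k = some c → (k, σ) ∈ G ∧ b (k, σ) = val c

open Classical in
/-- update of labels -/
noncomputable def upd (β : Γ.K → Option Γ.K) (y : Γ.A × Γ.S) (k' : Γ.K) : Option Γ.K :=
  if h : ∃ c k, β k = some c ∧ 0 < Γ.q k y.1 (k', y.2) then some h.choose else none

lemma upd_some {β : Γ.K → Option Γ.K} {y : Γ.A × Γ.S} {k' c} (h : upd β y k' = some c) :
    ∃ k, β k = some c ∧ 0 < Γ.q k y.1 (k', y.2) := by
  unfold upd at h
  split_ifs at h with h1
  have := h1.choose_spec
  rw [Option.some.inj h] at this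
  exact this

lemma upd_isSome {β : Γ.K → Option Γ.K} {y : Γ.A × Γ.S} {k k' c} (h : β k = some c)
    (hq : 0 < Γ.q k y.1 (k', y.2)) : ∃ c', upd β y k' = some c' := by
  have h1 : ∃ c k, β k = some c ∧ 0 < Γ.q k y.1 (k', y.2) := ⟨c, k, h, hq⟩
  exact ⟨_, by unfold upd; rw [dif_pos h1]⟩

lemma compat_upd (hG : ∀ x ∈ G, ∀ y, 0 < Γ.w y x → Γ.th y x ∈ G ∧ b (Γ.th y x) = b x)
    {β : Γ.K → Option Γ.K} {σ : Γ.Strategy} (h : Compat b G val β σ) (s : Γ.S) :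
    Compat b G val (upd β (σ [], s)) (fun h => σ ((σ [], s) :: h)) := by
  intro k' c hc
  obtain ⟨k, hk, hq⟩ := upd_some hc
  obtain ⟨h1, h2⟩ := h k c hk
  obtain ⟨h3, h4⟩ := hG _ h1 (k', s) hq
  exact ⟨h3, h4.trans h2⟩

end comb

lemma thmB (b : Γ.XS → ℝ) (hbI : ∀ x, b x ∈ Set.Icc (0:ℝ) 1) (G : Set Γ.XS) (ns : ℕ → ℕ) (hns : StrictMono ns)
    (hG : ∀ x ∈ G, ∀ y, 0 < Γ.w y x → Γ.th y x ∈ G ∧ b (Γ.th y x) = b x)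
    (hlim : ∀ x ∈ G, Tendsto (fun j => Γ.Av (ns j) x) atTop (𝓝 (b x)))
    (σ0 : Γ.Strategy) {ε : ℝ} (hε : 0 < ε) (hε1 : ε ≤ 1) :
    ∃ τ, Γ.FiniteMemory τ ∧ Γ.Cert τ (fun k => G.indicator b (k, σ0) - ε) := by
  classical
  let val : Γ.K → ℝ := fun k => b (k, σ0)
  let β0 : Γ.K → Option Γ.K := fun k => if (k, σ0) ∈ G then some k else none
  have hβ0 : Compat b G val β0 σ0 := by
    intro k c hc
    simp only [β0] at hc
    split_ifs at hc with h
    cases hc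
    exact ⟨h, rfl⟩
  let rep : (Γ.K → Option Γ.K) → Γ.Strategy := fun β =>
    if h : ∃ σ, Compat b G val β σ then h.choose else σ0
  have hrep : ∀ β σ, Compat b G val β σ → Compat b G val β (rep β) := by
    intro β σ h
    have h1 : ∃ σ, Compat b G val β σ := ⟨σ, h⟩
    simp only [rep, dif_pos h1]
    exact h1.choose_spec
  obtain ⟨n0, hn0, hAv⟩ : ∃ n0 : ℕ, 1 ≤ n0 ∧ ∀ β, Compat b G val β (rep β) → ∀ k c, β k = some c →
      b (k, rep β) - ε ≤ Γ.Av n0 (k, rep β) := by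
    have h1 : ∀ᶠ j in atTop, ∀ β k, Compat b G val β (rep β) → ∀ c, β k = some c →
        b (k, rep β) - ε ≤ Γ.Av (ns j) (k, rep β) := by
      refine eventually_all.2 fun β => eventually_all.2 fun k => ?_
      by_cases h : (k, rep β) ∈ G
      · filter_upwards [(tendsto_order.1 (hlim _ h)).1 (b (k, rep β) - ε) (by linarith)] with j hj _ c _
        exact hj.le
      · exact Eventually.of_forall fun j hC c hc => absurd (hC k c hc).1 h
    obtain ⟨j, hj, hj1⟩ := (h1.and (eventually_ge_atTop 1)).exists
    exact ⟨ns j, hj1.trans (hns.id_le j), fun β hβ k c hc => hj β k hβ c hc⟩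
  -- automaton
  let M := (Γ.K → Option Γ.K) × Γ.Hist
  let u : M → Γ.A × Γ.S → M := fun m y =>
    if m.2.length + 1 < n0 then (m.1, m.2 ++ [y]) else ((m.2 ++ [y]).foldl upd m.1, [])
  let φ : Γ.Hist → M := fun h => h.foldl u (β0, [])
  have hφ : ∀ h y, φ (h ++ [y]) = u (φ h) y := fun h y => by simp [φ, List.foldl_append]
  have hlen : ∀ h, (φ h).2.length < n0 := by
    intro h
    induction h using List.reverseRecOn with
    | nil => simp only [φ, List.foldl_nil, List.length_nil]; omega
    | append_singleton h y ih =>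
      rw [hφ]
      simp only [u]
      split_ifs with h1
      · simpa using h1
      · simp only [List.length_nil]; omega
  let τ : Γ.Strategy := fun h => rep (φ h).1 (φ h).2
  have hfin : (Set.range φ).Finite := by
    refine (Set.finite_univ.prod (List.finite_length_lt (Γ.A × Γ.S) n0)).subset ?_
    rintro _ ⟨h, rfl⟩
    exact ⟨Set.mem_univ _, hlen h⟩
  refine ⟨τ, Γ.fm_of φ u (fun m => rep m.1 m.2) τ hfin hφ fun _ => rfl, ?_⟩
  let cur : M → Γ.K → Option Γ.K := fun m => m.2.foldl upd m.1
  let sc : M → Γ.Strategy := fun m h => rep m.1 (m.2 ++ h)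
  let Good : M → Prop := fun m => Compat b G val m.1 (rep m.1) ∧ Compat b G val (cur m) (sc m)
  have hsc0 : ∀ h, sc (φ h) [] = τ h := fun h => by simp [sc, τ]
  -- preservation
  have hpres : ∀ h s, Good (φ h) → Good (φ (h ++ [(τ h, s)])) := by
    intro h s ⟨g1, g2⟩
    have h1 := compat_upd b G val hG g2 s
    rw [hsc0] at h1
    rw [hφ]
    simp only [u]
    have hcur : upd (cur (φ h)) (τ h, s) = ((φ h).2 ++ [(τ h, s)]).foldl upd (φ h).1 := by
      simp [cur, List.foldl_append]
    split_ifs with hl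
    · refine ⟨g1, ?_⟩
      simp only [cur, sc]
      rw [← hcur]
      simpa [sc] using h1
    · have h2 := hrep _ _ h1
      rw [hcur] at h2
      exact ⟨h2, by simpa [cur, sc] using h2⟩
  let Lab : Γ.K × Γ.Hist → Prop := fun x => Good (φ x.2) ∧ ∃ c, cur (φ x.2) x.1 = some c
  let B : Γ.K × Γ.Hist → ℝ := fun x => b (x.1, sc (φ x.2))
  -- labelled transitions
  have hstep : ∀ x y, Lab x → 0 < Γ.q x.1 (τ x.2) y → Lab (y.1, x.2 ++ [(τ x.2, y.2)]) ∧
      B (y.1, x.2 ++ [(τ x.2, y.2)]) = B x ∧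
      ((φ x.2).2.length + 1 < n0 → (y.1, sc (φ (x.2 ++ [(τ x.2, y.2)]))) = Γ.th y (x.1, sc (φ x.2)) ∧
        (φ (x.2 ++ [(τ x.2, y.2)])).2.length = (φ x.2).2.length + 1) ∧
      (¬ (φ x.2).2.length + 1 < n0 → (φ (x.2 ++ [(τ x.2, y.2)])).2 = []) := by
    rintro ⟨k, h⟩ ⟨k', s⟩ ⟨hg, c, hc⟩ hq
    simp only at hc hq hg ⊢
    have hg' := hpres h s hg
    have hcur : upd (cur (φ h)) (τ h, s) = cur (φ (h ++ [(τ h, s)])) := by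
      rw [hφ]; simp only [u]
      split_ifs with hl <;> simp [cur, List.foldl_append]
    obtain ⟨c', hc'⟩ := upd_isSome (y := (τ h, s)) hc hq
    have hB1 := (compat_upd b G val hG hg.2 s)
    rw [hsc0] at hB1
    have hB2 := (hB1 k' c' hc').2
    have hB3 := (hg'.2 k' c' (by rw [← hcur]; exact hc')).2
    have hx := hG _ (hg.2 k c hc).1 (k', s) (by simp only [w, hsc0]; exact hq)
    refine ⟨⟨hg', c', by simp only; rw [← hcur]; exact hc'⟩, ?_, ?_, ?_⟩
    · simp only [B]
      rw [hB3, ← hB2, ← hx.2]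
      simp only [th, hsc0]
    · intro hl
      rw [hφ]; simp only [u, if_pos hl]
      refine ⟨?_, by simp⟩
      simp [th, sc, τ]
    · intro hl
      rw [hφ]; simp only [u, if_neg hl]
  let tt : Γ.K × Γ.Hist → ℕ := fun x => n0 - (φ x.2).2.length
  have htt : ∀ x, 1 ≤ tt x ∧ tt x ≤ n0 := fun x => by
    have := hlen x.2; simp only [tt]; omega
  let V : Γ.K × Γ.Hist → ℝ := fun x =>
    if Lab x then Γ.St (tt x) (x.1, sc (φ x.2)) - (B x - ε) * tt x else -(2 * n0)
  let c : Γ.K × Γ.Hist → ℝ := fun x => if Lab x then B x - ε else -ε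
  have hBI : ∀ x, B x ∈ Set.Icc (0:ℝ) 1 := fun x => hbI _
  have hn0' : (1:ℝ) ≤ n0 := by exact_mod_cast hn0
  have hVb : ∀ x, |V x| ≤ 2 * n0 := by
    intro x
    simp only [V]
    split_ifs with hx
    · have h1 := Γ.St_Icc (tt x) (x.1, sc (φ x.2))
      have h2 : (tt x : ℝ) ≤ n0 := by exact_mod_cast (htt x).2
      have h3 : (0:ℝ) ≤ tt x := by positivity
      have h4 := hBI x
      have h5 : |B x - ε| ≤ 1 := by rw [abs_le]; constructor <;> linarith [h4.1, h4.2]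
      have h6 : |(B x - ε) * tt x| ≤ n0 := by
        rw [abs_mul, abs_of_nonneg h3]
        nlinarith [abs_nonneg (B x - ε)]
      rw [abs_le] at h6 ⊢
      constructor <;> linarith [h1.1, h1.2]
    · rw [abs_neg, abs_of_nonneg (by positivity)]
  refine ⟨V, c, 2 * n0, hVb, ?_, ?_, ?_, ?_⟩
  · intro x
    have h4 := hBI x
    simp only [c]
    split_ifs <;> rw [abs_le] <;> constructor <;> linarith [h4.1, h4.2]
  · intro x y hy
    by_cases hx : Lab x
    · obtain ⟨h1, h2, -⟩ := hstep x y hx hy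
      simp only [c, if_pos hx, if_pos h1, h2]; exact le_rfl
    · simp only [c, if_neg hx]
      split_ifs
      · linarith [(hBI (y.1, x.2 ++ [(τ x.2, y.2)])).1]
      · exact le_rfl
  · intro x
    by_cases hx : Lab x
    · obtain ⟨t, ht⟩ : ∃ t, tt x = t + 1 := ⟨tt x - 1, by have := (htt x).1; omega⟩
      have hc : c x = B x - ε := if_pos hx
      have hVx : V x = Γ.St (t+1) (x.1, sc (φ x.2)) - (B x - ε) * (t + 1) := by
        simp only [V, if_pos hx, ht]; push_cast; rfl
      have hg : Γ.gh τ x = Γ.g0 (x.1, sc (φ x.2)) := by simp only [gh, g0, hsc0]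
      have hT : Γ.P (Γ.St t) (x.1, sc (φ x.2)) - (B x - ε) * t ≤ Γ.T τ V x := by
        have h1 : (B x - ε) * t = ∑ y, Γ.w y (x.1, sc (φ x.2)) * ((B x - ε) * t) := by
          rw [← Finset.sum_mul, w_sum, one_mul]
        rw [h1]
        simp only [P, T, ← Finset.sum_sub_distrib, ← mul_sub]
        refine Finset.sum_le_sum fun y _ => ?_
        have hw : Γ.w y (x.1, sc (φ x.2)) = Γ.q x.1 (τ x.2) y := by simp only [w, hsc0]
        rw [hw]
        rcases (Γ.q_nonneg x.1 (τ x.2) y).eq_or_lt with h0 | h0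
        · rw [← h0]; simp
        refine mul_le_mul_of_nonneg_left ?_ h0.le
        obtain ⟨h2, h3, h4, h5⟩ := hstep x y hx h0
        simp only [V, if_pos h2, h3]
        by_cases hl : (φ x.2).2.length + 1 < n0
        · obtain ⟨h6, h7⟩ := h4 hl
          have h8 : tt (y.1, x.2 ++ [(τ x.2, y.2)]) = t := by
            simp only [tt] at ht ⊢; rw [h7]; omega
          rw [h8, h6]
        · have h6 := h5 hl
          have h8 : tt (y.1, x.2 ++ [(τ x.2, y.2)]) = n0 := by
            simp only [tt]; rw [h6]; simp
          have ht0 : t = 0 := by simp only [tt] at ht; omega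
          rw [h8, ht0]
          have hs : sc (φ (x.2 ++ [(τ x.2, y.2)])) = rep (φ (x.2 ++ [(τ x.2, y.2)])).1 := by
            simp only [sc, h6]; rfl
          obtain ⟨hgd, c', hc'⟩ := h2
          have h9 := hAv _ hgd.1 y.1 c' (by simpa [cur, h6] using hc')
          rw [← hs] at h9
          have h10 : b (y.1, sc (φ (x.2 ++ [(τ x.2, y.2)]))) = B x := h3
          rw [h10] at h9
          have h11 : Γ.St n0 (y.1, sc (φ (x.2 ++ [(τ x.2, y.2)]))) =
              Γ.Av n0 (y.1, sc (φ (x.2 ++ [(τ x.2, y.2)]))) * n0 := by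
            simp only [Av, St]; field_simp
          simp only [St, Finset.range_zero, Finset.sum_empty, Nat.cast_zero, mul_zero, sub_zero] at h11 ⊢
          rw [h11, ← sub_mul]
          exact mul_nonneg (by linarith) (by positivity)
      rw [hc, hVx, hg, St_succ]
      linarith
    · have h1 : V x = -(2 * n0) := if_neg hx
      have h2 : c x = -ε := if_neg hx
      have h3 := Γ.T_bdd (σ := τ) hVb x
      have h4 := Γ.g_nonneg x.1 (τ x.2)
      simp only [gh]
      linarith [(abs_le.1 h3).1]
  · intro k
    by_cases hk : (k, σ0) ∈ G
    · have h1 := hrep _ _ hβ0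
      have hβk : β0 k = some k := if_pos hk
      have hL : Lab (k, []) := ⟨⟨h1, by simpa [φ, cur, sc] using h1⟩, k, by simpa [φ, cur] using hβk⟩
      simp only [c, if_pos hL, Set.indicator_of_mem hk]
      have h2 : B (k, []) = b (k, σ0) := by
        have := (h1 k k hβk).2
        simpa [B, φ, sc] using this
      rw [h2]
    · simp only [c, Set.indicator_of_notMem hk]
      split_ifs
      · linarith [(hBI (k, [])).1]
      · simp

end POMDP

end

section
open ProbabilityTheory Topology
namespace POMDP
variable (Γ : POMDP)

/-- continuation strategy -/
def sh (σ : Γ.Strategy) (h : Γ.Hist) : Γ.Strategy := fun h' => σ (h ++ h')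

lemma T_sh (σ : Γ.Strategy) (f : Γ.XS → ℝ) :
    Γ.T σ (fun x => f (x.1, Γ.sh σ x.2)) = fun x => Γ.P f (x.1, Γ.sh σ x.2) := by
  funext x
  have h : ∀ y : Γ.K × Γ.S, Γ.sh σ (x.2 ++ [(σ x.2, y.2)]) = fun h => σ (x.2 ++ (σ x.2, y.2) :: h) := by
    intro y; funext h; simp [sh]
  simp only [T, P, w, th, h]
  simp only [sh, List.append_nil]

lemma Tit_sh (σ : Γ.Strategy) (m : ℕ) (f : Γ.XS → ℝ) :
    (Γ.T σ)^[m] (fun x => f (x.1, Γ.sh σ x.2)) = fun x => Γ.P^[m] f (x.1, Γ.sh σ x.2) := by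
  induction m generalizing f with
  | zero => rfl
  | succ m ih => rw [Function.iterate_succ_apply, T_sh, ih, Function.iterate_succ_apply]

lemma sh_nil (σ : Γ.Strategy) : Γ.sh σ [] = σ := rfl

lemma traj_congr (σ τ : Γ.Strategy) (ω) (m : ℕ) (h : ∀ l : Γ.Hist, l.length < m → τ l = σ l) (j : ℕ) (hj : j ≤ m) :
    Γ.traj τ ω j = Γ.traj σ ω j := by
  induction j with
  | zero => rfl
  | succ j ih =>
    have h1 := ih (by omega)
    have h2 := h (Γ.traj σ ω j).2 (by rw [hist_len]; omega)
    simp only [traj, h1, h2]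

lemma composite {I : Type} [Fintype I] (τ : I → Γ.Strategy) (γ : I → Γ.K → ℝ)
    (hFM : ∀ i, Γ.FiniteMemory (τ i)) (hC : ∀ i, Γ.Cert (τ i) (γ i)) (N : Γ.Strategy → I)
    (σ : Γ.Strategy) (m : ℕ) (p : Γ.K → ℝ) (hp : IsBelief p) :
    ∃ τ', Γ.FiniteMemory τ' ∧
      ∑ k, p k * Γ.P^[m] (fun x => γ (N x.2) x.1) (k, σ) ≤ Γ.pay p τ' := by
  classical
  choose n m0 sa su hsa using hFM
  choose V c C hV hc hmono hpoi hγ using hC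
  let J : Γ.Hist → I := fun h => N (Γ.sh σ (h.take m))
  let τ' : Γ.Strategy := fun h => if h.length < m then σ h else τ (J h) (h.drop m)
  refine ⟨τ', ?_, ?_⟩
  · refine Γ.fm_of (M := Γ.Hist × (∀ i, Fin (n i)))
      (fun h => (h.take m, fun i => (h.drop m).foldl (su i) (m0 i)))
      (fun s y => if s.1.length < m then (s.1 ++ [y], s.2) else (s.1, fun i => su i (s.2 i) y))
      (fun s => if s.1.length < m then σ s.1 else sa (N (Γ.sh σ s.1)) (s.2 _)) τ' ?_ ?_ ?_
    · refine ((List.finite_length_le (Γ.A × Γ.S) m).prod (Set.finite_univ (α := ∀ i, Fin (n i)))).subset ?_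
      rintro _ ⟨h, rfl⟩
      refine ⟨?_, trivial⟩
      show (h.take m).length ≤ m
      simp
    · intro h y
      by_cases hl : h.length < m
      · have h1 : (h ++ [y]).length ≤ m := by simp; omega
        simp only [List.take_of_length_le h1, List.take_of_length_le hl.le, List.drop_of_length_le h1,
          List.drop_of_length_le hl.le, if_pos hl]
      · have hl' : m ≤ h.length := by omega
        have h2 : ¬ (h.take m).length < m := by simp; omega
        simp only [if_neg h2, List.take_append_of_le_length hl', List.drop_append_of_le_length hl',
          List.foldl_append, List.foldl_cons, List.foldl_nil]
    · intro h
      by_cases hl : h.length < m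
      · simp only [τ', List.take_of_length_le hl.le, if_pos hl]
      · have h2 : ¬ (h.take m).length < m := by simp; omega
        simp only [τ', if_neg hl, if_neg h2, J]
        exact hsa _ _
  · let C' : ℝ := ∑ i, |C i|
    have hC' : ∀ i, C i ≤ C' := fun i => (le_abs_self _).trans
      (Finset.single_le_sum (f := fun i => |C i|) (fun _ _ => abs_nonneg _) (Finset.mem_univ i))
    let c' : Γ.K × Γ.Hist → ℝ := fun x => c (J x.2) (x.1, x.2.drop m)
    let V' : Γ.K × Γ.Hist → ℝ := fun x => V (J x.2) (x.1, x.2.drop m)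
    have hJ : ∀ h : Γ.Hist, m ≤ h.length → ∀ y, J (h ++ [y]) = J h := fun h hl y => by
      simp only [J, List.take_append_of_le_length hl]
    have hD : ∀ h : Γ.Hist, m ≤ h.length → ∀ y, (h ++ [y]).drop m = h.drop m ++ [y] := fun h hl y =>
      List.drop_append_of_le_length hl
    have hτ' : ∀ h : Γ.Hist, m ≤ h.length → τ' h = τ (J h) (h.drop m) := fun h hl => by
      simp only [τ', if_neg (not_lt.2 hl)]
    have hg := Γ.guarantee τ' m V' c' C' (fun x => (hV _ _).trans (hC' _)) (fun x => (hc _ _).trans (hC' _))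
      (by
        intro x hx y hy
        rw [hτ' _ hx] at hy ⊢
        simp only [c', hJ _ hx, hD _ hx]
        exact hmono (J x.2) (x.1, x.2.drop m) y hy)
      (by
        intro x hx
        have := hpoi (J x.2) (x.1, x.2.drop m)
        simp only [T, gh, V', c', hτ' _ hx, hJ _ hx, hD _ hx] at this ⊢
        exact this) p hp
    refine le_trans ?_ hg
    refine Finset.sum_le_sum fun k _ => mul_le_mul_of_nonneg_left ?_ (hp.1 k)
    let F : Γ.K × Γ.Hist → ℝ := fun x => γ (N (Γ.sh σ x.2)) x.1
    let B : ℝ := ∑ i, ∑ k, |γ i k|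
    have hF : ∀ x, |F x| ≤ B := by
      intro x
      refine le_trans (Finset.single_le_sum (f := fun k => |γ (N (Γ.sh σ x.2)) k|)
        (fun _ _ => abs_nonneg _) (Finset.mem_univ x.1)) ?_
      exact Finset.single_le_sum (f := fun i => ∑ k, |γ i k|)
        (fun _ _ => Finset.sum_nonneg fun _ _ => abs_nonneg _) (Finset.mem_univ _)
    have he := Γ.expect σ k m hF
    have he2 := congrFun (Γ.Tit_sh σ m (fun x => γ (N x.2) x.1)) (k, [])
    have he3 : Γ.P^[m] (fun x => γ (N x.2) x.1) (k, σ) = ∫ x, F (Γ.traj σ (k, x) m) ∂lam := by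
      rw [he]; exact he2.symm
    rw [he3]
    refine integral_mono (integrable_bdd (Γ.measurable_traj' σ k m F) fun x => hF _)
      (integrable_bdd (Γ.measurable_traj' τ' k m c') fun x => (hc _ _).trans (hC' _)) fun x => ?_
    have hl := Γ.hist_len σ (k, x) m
    rw [Γ.traj_congr σ τ' (k, x) m (fun l hl => by simp only [τ', if_pos hl]) m le_rfl]
    simp only [F, c', J, List.take_of_length_le hl.le, List.drop_of_length_le hl.le]
    exact hγ _ _

/-- clopen approximation of a finite-valued measurable map -/
lemma clopen_approx {I : Type} [Fintype I] [Nonempty I] (ν : Measure Γ.Strategy) [IsProbabilityMeasure ν]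
    (N : Γ.Strategy → I) (hN : ∀ i, MeasurableSet (N ⁻¹' {i})) {δ : ℝ} (hδ : 0 < δ) :
    ∃ N' : Γ.Strategy → I, (∀ F : I → ℝ, Continuous fun s => F (N' s)) ∧
      ∃ E : Set Γ.Strategy, MeasurableSet E ∧ (∀ s ∉ E, N' s = N s) ∧ ν.real E ≤ δ := by
  classical
  have hring : IsSetRing {s : Set Γ.Strategy | IsClopen s} :=
    { empty_mem := isClopen_empty
      union_mem := fun _ _ hs ht => IsClopen.union hs ht
      sdiff_mem := fun _ _ hs ht => IsClopen.diff hs ht }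
  have hgen : (inferInstance : MeasurableSpace Γ.Strategy) =
      MeasurableSpace.generateFrom {s : Set Γ.Strategy | IsClopen s} := by
    rw [BorelSpace.measurable_eq (α := Γ.Strategy)]
    exact (isTopologicalBasis_isClopen (X := Γ.Strategy)).borel_eq_generateFrom
  have hap : ∀ i, ∃ t : Set Γ.Strategy, IsClopen t ∧
      ν (symmDiff t (N ⁻¹' {i})) < ENNReal.ofReal (δ / Fintype.card I) := by
    intro i
    obtain ⟨t, ht, h2⟩ := exists_measure_symmDiff_lt_of_generateFrom_isSetRing (μ := ν) hring
      ⟨{Set.univ}, Set.countable_singleton _, by simpa using isClopen_univ, by simp⟩ hgen (hN i)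
      (ε := ENNReal.ofReal (δ / Fintype.card I)) (by
        have : (0:ℝ) < Fintype.card I := by exact_mod_cast Fintype.card_pos
        simpa using by positivity)
    exact ⟨t, ht, h2⟩
  choose t ht hti using hap
  let pick : (I → Bool) → I := fun v => if h : ∃ i, v i = true then h.choose else Classical.arbitrary I
  let Jm : Γ.Strategy → (I → Bool) := fun s i => decide (s ∈ t i)
  have hJ : Continuous Jm := continuous_pi fun i => by
    rw [continuous_discrete_rng]
    intro b
    cases b with
    | true => convert (ht i).isOpen using 1; ext s; simp [Jm]
    | false => convert (ht i).compl.isOpen using 1; ext s; simp [Jm]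
  refine ⟨fun s => pick (Jm s), fun F => ?_, ⋃ i, symmDiff (t i) (N ⁻¹' {i}), ?_, ?_, ?_⟩
  · exact (continuous_of_discreteTopology (f := fun v => F (pick v))).comp hJ
  · exact MeasurableSet.iUnion fun i => (ht i).2.measurableSet.symmDiff (hN i)
  · intro s hs
    have hs' : ∀ i, s ∈ t i ↔ N s = i := by
      intro i
      have := fun h => hs (Set.mem_iUnion.2 ⟨i, h⟩)
      simp only [Set.mem_symmDiff, Set.mem_preimage, Set.mem_singleton_iff] at this
      tauto
    have hex : ∃ i, Jm s i = true := ⟨N s, by simp [Jm, hs']⟩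
    have := hex.choose_spec
    simp only [pick, dif_pos hex]
    exact ((hs' _).1 (of_decide_eq_true this)).symm
  · refine ENNReal.toReal_le_of_le_ofReal hδ.le ?_
    refine (measure_iUnion_fintype_le ν _).trans ?_
    refine (Finset.sum_le_sum fun i _ => (hti i).le).trans ?_
    rw [Finset.sum_const, nsmul_eq_mul, ← ENNReal.ofReal_natCast, ← ENNReal.ofReal_mul (by positivity)]
    refine ENNReal.ofReal_le_ofReal (le_of_eq ?_)
    have : (0:ℝ) < Fintype.card I := by exact_mod_cast Fintype.card_pos
    rw [Finset.card_univ]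
    field_simp

lemma g0_pay {p : Γ.K → ℝ} (hp : IsBelief p) (σ : Γ.Strategy) {a : ℝ}
    (h : Tendsto (fun n => Γ.Lam p σ n Γ.g0) (hyperfilter ℕ) (𝓝 a)) : Γ.pay p σ ≤ a := by
  refine le_of_forall_pos_le_add fun δ hδ => ?_
  rw [← sub_le_iff_le_add]
  refine ge_of_tendsto h ?_
  have h1 : ∀ᶠ n : ℕ in atTop, ∀ k, Γ.payk σ k - δ ≤
      (1 / n : ℝ) * ∑ m ∈ Finset.range n, (Γ.T σ)^[m] (Γ.gh σ) (k, []) :=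
    eventually_all.2 fun k => Γ.payk_le σ k hδ
  filter_upwards [Nat.hyperfilter_le_atTop h1] with n hn
  have h2 : ∀ m k, (Γ.T σ)^[m] (Γ.gh σ) (k, []) = Γ.P^[m] Γ.g0 (k, σ) := by
    intro m k
    have := congrFun (Γ.Tit_sh σ m Γ.g0) (k, [])
    simp only [sh_nil] at this
    rw [← this]
    have h3 : Γ.gh σ = fun x => Γ.g0 (x.1, Γ.sh σ x.2) := by
      funext x
      simp [gh, g0, sh]
    rw [h3]
  simp only [h2] at hn
  rw [Γ.pay_eq p hp, Lam, Finset.sum_comm, Finset.mul_sum]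
  calc _ = ∑ k, p k * (Γ.payk σ k - δ) := by
        simp only [mul_sub, Finset.sum_sub_distrib, ← Finset.sum_mul, hp.2, one_mul]
    _ ≤ _ := Finset.sum_le_sum fun k _ => by
        rw [← Finset.mul_sum, mul_left_comm]
        exact mul_le_mul_of_nonneg_left (hn k) (hp.1 k)

end POMDP

end

section
open ProbabilityTheory Topology
namespace POMDP
variable (Γ : POMDP)

lemma pay_le_one {p : Γ.K → ℝ} (hp : IsBelief p) (σ : Γ.Strategy) : Γ.pay p σ ≤ 1 := by
  obtain ⟨μ, hμ, -, h⟩ := Γ.exists_measure hp σ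
  refine (Γ.g0_pay hp σ (h _ Γ.cont_g0)).trans ?_
  calc _ ≤ ∫ x, (1:ℝ) ∂μ := integral_mono (Γ.integrable_of_Icc μ Γ.cont_g0.measurable Γ.g0_Icc)
        (integrable_const _) fun x => (Γ.g0_Icc x).2
    _ = 1 := by simp

lemma main {p : Γ.K → ℝ} (hp : IsBelief p) (σ : Γ.Strategy) {δ : ℝ} (hδ : 0 < δ) (hδ1 : δ ≤ 1) :
    ∃ τ, Γ.FiniteMemory τ ∧ Γ.pay p σ - 5 * δ ≤ Γ.pay p τ := by
  classical
  obtain ⟨μ, hμ, hinv, hlimμ⟩ := Γ.exists_measure hp σ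
  obtain ⟨b, ns, G, hbm, hbI, hns, hGm, hGae, hG, hlim, hint⟩ := Γ.ergodic hinv
  set bh : Γ.XS → ℝ := G.indicator b with hbh
  have hbhm : Measurable bh := hbm.indicator hGm
  have hbhI : ∀ x, bh x ∈ Set.Icc (0:ℝ) 1 := by
    intro x
    by_cases hx : x ∈ G
    · simpa [hbh, hx] using hbI x
    · simp [hbh, hx]
  have hbint : ∫ x, bh x ∂μ = ∫ x, Γ.g0 x ∂μ := by
    rw [← hint]
    refine integral_congr_ae ?_
    filter_upwards [hGae] with x hx
    simp [hbh, hx]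
  let M : ℕ := ⌊1 / δ⌋₊
  have hfl : ∀ x, ⌊bh x / δ⌋₊ ≤ M := fun x =>
    Nat.floor_le_floor (div_le_div_of_nonneg_right (hbhI x).2 hδ.le)
  let N : Γ.Strategy → (Γ.K → Fin (M + 1)) := fun s k =>
    ⟨⌊bh (k, s) / δ⌋₊, Nat.lt_succ_of_le (hfl _)⟩
  have hNm : Measurable N := by
    refine measurable_pi_lambda _ fun k => ?_
    have h1 : Measurable (fun s : Γ.Strategy => ⌊bh (k, s) / δ⌋₊) :=
      Nat.measurable_floor.comp ((hbhm.comp (measurable_const.prodMk measurable_id)).div_const δ)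
    have h2 : Measurable (fun n : ℕ => (⟨min n M, by omega⟩ : Fin (M+1))) := measurable_from_nat
    have h3 := h2.comp h1
    convert h3 using 1
    funext s
    simp only [Function.comp, N, min_eq_left (hfl (k, s))]
  have hNr : ∀ s s', N s = N s' → ∀ k, bh (k, s) - δ ≤ bh (k, s') := by
    intro s s' h k
    have h1 : ⌊bh (k, s) / δ⌋₊ = ⌊bh (k, s') / δ⌋₊ := by
      simpa [N] using congrFun h k
    have h2 := Nat.lt_floor_add_one (bh (k, s) / δ)
    have h3 := Nat.floor_le (div_nonneg (hbhI (k, s')).1 hδ.le)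
    rw [h1] at h2
    have h4 : bh (k, s) / δ < bh (k, s') / δ + 1 := by linarith
    rw [div_lt_iff₀ hδ, add_mul, div_mul_cancel₀ _ hδ.ne'] at h4
    linarith
  let rep : (Γ.K → Fin (M+1)) → Γ.Strategy := Function.invFun N
  have hrep : ∀ s, N (rep (N s)) = N s := fun s => Function.invFun_eq ⟨s, rfl⟩
  have hB := fun i => Γ.thmB b hbI G ns hns hG hlim (rep i) hδ hδ1
  choose τ hFM hcert using hB
  let γ : (Γ.K → Fin (M+1)) → Γ.K → ℝ := fun i k => bh (k, rep i) - δ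
  let ν : Measure Γ.Strategy := μ.map Prod.snd
  have hν : IsProbabilityMeasure ν := Measure.isProbabilityMeasure_map measurable_snd.aemeasurable
  obtain ⟨N', hN'c, E, hEm, hE, hνE⟩ := Γ.clopen_approx ν N (fun i => hNm (measurableSet_singleton i)) hδ
  let f : Γ.XS → ℝ := fun x => γ (N' x.2) x.1
  have hfc : Continuous f := continuous_prod_of_discrete_left.2 fun k => hN'c fun i => γ i k
  have hfI : ∀ x, f x ∈ Set.Icc (-δ) 1 := fun x => by
    have := hbhI (x.1, rep (N' x.2))
    constructor
    · simp only [f, γ]; linarith [this.1]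
    · simp only [f, γ]; linarith [this.2]
  let E' : Set Γ.XS := Prod.snd ⁻¹' E
  have hE'm : MeasurableSet E' := measurable_snd hEm
  have hE' : μ.real E' ≤ δ := by
    have : ν.real E = μ.real E' := by
      simp only [ν, Measure.real, Measure.map_apply measurable_snd hEm, E']
    rw [← this]; exact hνE
  have hpt : ∀ x, bh x - 2 * δ - E'.indicator (fun _ => (2:ℝ)) x ≤ f x := by
    intro x
    by_cases hx : x ∈ E'
    · rw [Set.indicator_of_mem hx]
      linarith [(hbhI x).2, (hfI x).1]
    · rw [Set.indicator_of_notMem hx]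
      have h1 : N' x.2 = N x.2 := hE _ hx
      have h2 := hNr x.2 (rep (N x.2)) (hrep _).symm x.1
      simp only [f, γ, h1]
      have h3 : bh (x.1, x.2) = bh x := rfl
      linarith
  have hi1 := Γ.integrable_of_Icc μ hbhm hbhI
  have hi2 : Integrable (E'.indicator (fun _ => (2:ℝ))) μ := (integrable_const _).indicator hE'm
  have hf1 : Γ.pay p σ - 4 * δ ≤ ∫ x, f x ∂μ := by
    have h1 := integral_mono ((hi1.sub (integrable_const (2 * δ))).sub hi2)
      (Γ.integrable_of_Icc μ hfc.measurable hfI) hpt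
    have h2 : ∫ x, (bh x - 2 * δ - E'.indicator (fun _ => (2:ℝ)) x) ∂μ
        = (∫ x, bh x ∂μ) - 2 * δ - μ.real E' * 2 := by
      have hi3 : Integrable (fun x => bh x - 2 * δ) μ := hi1.sub (integrable_const (2 * δ))
      rw [integral_sub hi3 hi2, integral_sub hi1 (integrable_const _),
        integral_indicator hE'm]
      simp
    have h3 := Γ.g0_pay hp σ (hlimμ _ Γ.cont_g0)
    have h4 : (∫ x, bh x ∂μ) - 2 * δ - μ.real E' * 2 ≤ ∫ x, f x ∂μ := by
      rw [← h2]; exact h1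
    linarith
  have hev := (hlimμ f hfc).eventually (lt_mem_nhds (show Γ.pay p σ - 5 * δ < ∫ x, f x ∂μ by linarith))
  have hev2 := hev.and (Nat.hyperfilter_le_atTop (eventually_ge_atTop 1))
  obtain ⟨n, hn, hn1⟩ := hev2.exists
  have hm : ∃ m ∈ Finset.range n, Γ.pay p σ - 5 * δ ≤ ∑ k, p k * Γ.P^[m] f (k, σ) := by
    by_contra hcon
    push Not at hcon
    have hs : ∑ m ∈ Finset.range n, ∑ k, p k * Γ.P^[m] f (k, σ) ≤
        ∑ m ∈ Finset.range n, (Γ.pay p σ - 5 * δ) := Finset.sum_le_sum fun m hm => (hcon m hm).le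
    rw [Finset.sum_const, Finset.card_range, nsmul_eq_mul] at hs
    have hn0 : (0:ℝ) < n := by exact_mod_cast hn1
    unfold Lam at hn
    have := mul_le_mul_of_nonneg_left hs (show (0:ℝ) ≤ 1 / n by positivity)
    rw [← mul_assoc, one_div_mul_cancel hn0.ne', one_mul] at this
    linarith
  obtain ⟨m, -, hm⟩ := hm
  obtain ⟨τ', h1, h2⟩ := Γ.composite τ γ hFM hcert N' σ m p hp
  exact ⟨τ', h1, hm.trans h2⟩

end POMDP

end

/-- **Theorem 1 (POMDPs).** For every POMDP `Γ`, initial belief `p₁` and `ε > 0`, there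
exists an `ε`-optimal strategy in `Γ(p₁)` that has finite memory. -/
theorem finiteMemory_eps_optimal (Γ : POMDP) (p1 : Γ.K → ℝ) (hp1 : IsBelief p1)
    (ε : ℝ) (hε : 0 < ε) :
    ∃ σ : Γ.Strategy, Γ.FiniteMemory σ ∧ Γ.pay p1 σ ≥ Γ.val p1 - ε := by
  have hδ : 0 < min 1 (ε / 10) := lt_min one_pos (by positivity)
  have hδ2 : min 1 (ε / 10) ≤ ε / 10 := min_le_right _ _
  have hlt : Γ.val p1 - min 1 (ε / 10) < ⨆ σ : Γ.Strategy, Γ.pay p1 σ := by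
    have : Γ.val p1 = ⨆ σ : Γ.Strategy, Γ.pay p1 σ := rfl
    linarith
  obtain ⟨σ, hσ⟩ := exists_lt_of_lt_ciSup hlt
  obtain ⟨τ, h1, h2⟩ := Γ.main hp1 σ hδ (min_le_left _ _)
  exact ⟨τ, h1, by linarith⟩

end PomdpPaper
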